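/- arXiv:2103.01729 — 3 statements merged into one kernel-verified Lean document; each statement's English description precedes it below -/
import Mathlib

section
/- Let n ≥ 3 and x ∈ Λ_n, and let p̃_{n,x} ∈ C_q^s(n,2) be the canonical correlation. Let p ∈ C_q(n,2) be induced by a strategy (ψ ∈ ℂ^{d_A} ⊗ ℂ^{d_B}, {E_v, I − E_v}_{v=1}^n, {F_w, I − F_w}_{w=1}^n), and let ρ_A, ρ_B be the reduced density matrices of ψψ*. If ‖p − p̃_{n,x}‖₁ ≤ δ for some δ ≥ 0, then, setting C = √(n² + (1+2x)√δ), one has ‖E_v² − E_v‖_{ρ_A} ≤ C·δ^{1/4} for every v ∈ [n] and ‖x·I_{d_A} − Σ_{v=1}^n E_v‖_{ρ_A} ≤ C·δ^{1/4}; similarly ‖F_w² − F_w‖_{ρ_B} ≤ C·δ^{1/4} for every w ∈ [n] and ‖x·I_{d_B} − Σ_{w=1}^n F_w‖_{ρ_B} ≤ C·δ^{1/4}. -/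
open scoped Matrix Kronecker ComplexOrder

noncomputable section
namespace QST

/-- Euclidean norm of a finite complex vector. -/
def evnorm {ι : Type} [Fintype ι] (v : ι → ℂ) : ℝ :=
  Real.sqrt (∑ i, ‖v i‖ ^ 2)

/-- Inner product `⟨v, w⟩`, linear in the first argument. -/
def pinner {ι : Type} [Fintype ι] (v w : ι → ℂ) : ℂ :=
  ∑ i, v i * (starRingEnd ℂ) (w i)

/-- Reduced density matrix of `ψψ*` on the first tensor factor. -/
def rhoA {dA dB : ℕ} (ψ : Fin dA × Fin dB → ℂ) : Matrix (Fin dA) (Fin dA) ℂ :=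
  Matrix.of fun a a' => ∑ b, ψ (a, b) * (starRingEnd ℂ) (ψ (a', b))

/-- Reduced density matrix of `ψψ*` on the second tensor factor. -/
def rhoB {dA dB : ℕ} (ψ : Fin dA × Fin dB → ℂ) : Matrix (Fin dB) (Fin dB) ℂ :=
  Matrix.of fun b b' => ∑ a, ψ (a, b) * (starRingEnd ℂ) (ψ (a, b'))

/-- The state-dependent seminorm `‖X‖_ρ = (tr (X* X ρ))^(1/2)`. -/
def rnorm {d : ℕ} (ρ X : Matrix (Fin d) (Fin d) ℂ) : ℝ :=
  Real.sqrt ((Xᴴ * X * ρ).trace).re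

/-- Operator (spectral) norm of a matrix. -/
def opNorm {d : ℕ} (X : Matrix (Fin d) (Fin d) ℂ) : ℝ :=
  ‖Matrix.toEuclideanCLM (𝕜 := ℂ) X‖

/-- `P = P* = P²`. -/
def IsProjection {d : ℕ} (P : Matrix (Fin d) (Fin d) ℂ) : Prop :=
  Pᴴ = P ∧ P * P = P

/-- 1-norm distance between correlations. -/
def dist1 {n k : ℕ} (p q : Fin n → Fin n → Fin k → Fin k → ℝ) : ℝ :=
  ∑ v, ∑ w, ∑ i, ∑ j, |p v w i j - q v w i j|

/-- Membership in the set `C_q(n,k)` of quantum correlations. -/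
def IsQuantumCorrelation (n k : ℕ) (p : Fin n → Fin n → Fin k → Fin k → ℝ) : Prop :=
  ∃ (dA dB : ℕ) (ψ : Fin dA × Fin dB → ℂ)
    (E : Fin n → Fin k → Matrix (Fin dA) (Fin dA) ℂ)
    (F : Fin n → Fin k → Matrix (Fin dB) (Fin dB) ℂ),
    evnorm ψ = 1 ∧ (∀ v i, (E v i).PosSemidef) ∧ (∀ v, ∑ i, E v i = 1) ∧
    (∀ w j, (F w j).PosSemidef) ∧ (∀ w, ∑ j, F w j = 1) ∧
    ∀ v w i j, (p v w i j : ℂ) = pinner ((E v i ⊗ₖ F w j).mulVec ψ) ψ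

/-- Strategy 1 (the "tilde" strategy) is a local `ε`-dilation of strategy 2. -/
def IsLocalDilation {n k : ℕ} (ε : ℝ) {d1A d1B d2A d2B : ℕ}
    (ψ1 : Fin d1A × Fin d1B → ℂ)
    (E1 : Fin n → Fin k → Matrix (Fin d1A) (Fin d1A) ℂ)
    (F1 : Fin n → Fin k → Matrix (Fin d1B) (Fin d1B) ℂ)
    (ψ2 : Fin d2A × Fin d2B → ℂ)
    (E2 : Fin n → Fin k → Matrix (Fin d2A) (Fin d2A) ℂ)
    (F2 : Fin n → Fin k → Matrix (Fin d2B) (Fin d2B) ℂ) : Prop :=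
  ∃ (kA kB : ℕ) (VA : Matrix (Fin d1A × Fin kA) (Fin d2A) ℂ)
    (VB : Matrix (Fin d1B × Fin kB) (Fin d2B) ℂ) (χ : Fin kA × Fin kB → ℂ),
    VAᴴ * VA = 1 ∧ VBᴴ * VB = 1 ∧ evnorm χ = 1 ∧
    evnorm (fun y : (Fin d1A × Fin d1B) × (Fin kA × Fin kB) =>
        ((VA ⊗ₖ VB).mulVec ψ2) ((y.1.1, y.2.1), (y.1.2, y.2.2)) - ψ1 y.1 * χ y.2) ≤ ε ∧
    ∀ (v w : Fin n) (i j : Fin k),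
      evnorm (fun y : (Fin d1A × Fin d1B) × (Fin kA × Fin kB) =>
        ((VA ⊗ₖ VB).mulVec ((E2 v i ⊗ₖ F2 w j).mulVec ψ2)) ((y.1.1, y.2.1), (y.1.2, y.2.2))
          - ((E1 v i ⊗ₖ F1 w j).mulVec ψ1) y.1 * χ y.2) ≤ ε

/-- The sequence generating `Λ_n` for `n ≥ 4`. -/
def lambdaSeq (n : ℕ) : ℕ → ℝ
  | 0 => 0
  | l + 1 => 1 + 1 / ((n : ℝ) - 1 - lambdaSeq n l)

/-- The sets `Λ_n`. -/
def Lambda (n : ℕ) : Set ℝ :=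
  if n = 3 then {3 / 2} else Set.range (lambdaSeq n)

/-- The maximally entangled state `φ_d`. -/
def phid (d : ℕ) : Fin d × Fin d → ℂ :=
  fun y => if y.1 = y.2 then (((Real.sqrt d)⁻¹ : ℝ) : ℂ) else 0

/-- The two-outcome measurement `{M, 1 - M}`. -/
def canonPair {d : ℕ} (M : Matrix (Fin d) (Fin d) ℂ) : Fin 2 → Matrix (Fin d) (Fin d) ℂ :=
  fun i => if i = 0 then M else 1 - M

theorem om_nonneg_aux {ι : Type} [Fintype ι] (ψ : ι → ℂ) {M : Matrix ι ι ℂ}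
    (hM : M.PosSemidef) : 0 ≤ (pinner (M.mulVec ψ) ψ).re := by
  have h := hM.dotProduct_mulVec_nonneg ψ
  have h2 := (Complex.le_def.1 h).1
  have h3 : pinner (M.mulVec ψ) ψ = star ψ ⬝ᵥ M *ᵥ ψ := by
    simp only [pinner, dotProduct, Pi.star_apply, starRingEnd_apply]
    exact Finset.sum_congr rfl fun i _ => mul_comm _ _
  rw [h3]; simpa using h2

def om {ι : Type} [Fintype ι] (ψ : ι → ℂ) : Matrix ι ι ℂ →ₗ[ℝ] ℝ where
  toFun M := (pinner (M.mulVec ψ) ψ).re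
  map_add' M N := by
    simp [pinner, Matrix.add_mulVec, add_mul, Finset.sum_add_distrib]
  map_smul' r M := by
    simp only [pinner, Matrix.smul_mulVec, Pi.smul_apply, RingHom.id_apply, smul_mul_assoc,
      ← Finset.smul_sum, Complex.smul_re]

theorem om_apply {ι : Type} [Fintype ι] (ψ : ι → ℂ) (M : Matrix ι ι ℂ) :
    om ψ M = (pinner (M.mulVec ψ) ψ).re := rfl

theorem om_nonneg {ι : Type} [Fintype ι] (ψ : ι → ℂ) {M : Matrix ι ι ℂ}
    (hM : M.PosSemidef) : 0 ≤ om ψ M := om_nonneg_aux ψ hM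

theorem om_one {ι : Type} [Fintype ι] [DecidableEq ι] (ψ : ι → ℂ) (h : evnorm ψ = 1) :
    om ψ 1 = 1 := by
  rw [evnorm, Real.sqrt_eq_one] at h
  rw [om_apply, pinner, Matrix.one_mulVec, Complex.re_sum, ← h]
  refine Finset.sum_congr rfl fun i _ => ?_
  rw [Complex.mul_conj, Complex.normSq_eq_norm_sq]
  norm_cast

theorem psd_sub_sq {ι : Type} [Fintype ι] [DecidableEq ι] {A : Matrix ι ι ℂ}
    (hA : A.PosSemidef) (hA' : (1 - A).PosSemidef) : (A - A * A).PosSemidef := by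
  have h1 := hA'.mul_mul_conjTranspose_same A
  have h2 := hA.mul_mul_conjTranspose_same (1 - A)
  rw [hA.1.eq] at h1
  rw [hA'.1.eq] at h2
  have h3 := h1.add h2
  have : A * (1 - A) * A + (1 - A) * A * (1 - A) = A - A * A := by noncomm_ring
  rwa [this] at h3

theorem psd_sq {ι : Type} [Fintype ι] [DecidableEq ι] {A : Matrix ι ι ℂ}
    (hA : A.IsHermitian) : (A * A).PosSemidef := by
  have h1 := Matrix.posSemidef_conjTranspose_mul_self A
  rwa [hA.eq] at h1

theorem om_comm {ι : Type} [Fintype ι] [DecidableEq ι] (ψ : ι → ℂ) {X Y : Matrix ι ι ℂ}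
    (hX : X.IsHermitian) (hY : Y.IsHermitian) : om ψ (X * Y) = om ψ (Y * X) := by
  have key : ∀ M : Matrix ι ι ℂ, om ψ (Mᴴ) = om ψ M := by
    intro M
    have : pinner (Mᴴ.mulVec ψ) ψ = star (pinner (M.mulVec ψ) ψ) := by
      simp only [pinner, Matrix.mulVec, dotProduct, Matrix.conjTranspose_apply, star_sum,
        star_mul', starRingEnd_apply, star_star, Finset.sum_mul]
      rw [Finset.sum_comm]
      refine Finset.sum_congr rfl fun i _ => Finset.sum_congr rfl fun j _ => ?_
      ring
    rw [om_apply, om_apply, this]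
    simp
  rw [← key (X * Y), Matrix.conjTranspose_mul, hX.eq, hY.eq]

theorem om_cs {ι : Type} [Fintype ι] [DecidableEq ι] (ψ : ι → ℂ) {X Y : Matrix ι ι ℂ}
    (hX : X.IsHermitian) (hY : Y.IsHermitian) (h1 : om ψ (X * X) ≤ 1) {s : ℝ} (hs : 0 ≤ s)
    (h2 : om ψ (Y * Y) ≤ s ^ 2) : om ψ (X * Y) ≤ s := by
  refine le_of_forall_gt_imp_ge_of_dense fun t ht => ?_
  have ht0 : 0 < t := hs.trans_lt ht
  have hH : (t • X - Y).IsHermitian := by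
    refine Matrix.IsHermitian.sub ?_ hY
    rw [Matrix.IsHermitian, Matrix.conjTranspose_smul, hX.eq]
    simp
  have h := om_nonneg ψ (psd_sq hH)
  have e : (t • X - Y) * (t • X - Y) = t ^ 2 • (X * X) - t • (X * Y) - t • (Y * X) + Y * Y := by
    simp only [sub_mul, mul_sub, smul_mul_assoc, mul_smul_comm, smul_sub, smul_smul, pow_two]
    abel
  rw [e] at h
  simp only [map_add, map_sub, map_smul, smul_eq_mul] at h
  rw [om_comm ψ hY hX] at h
  have h3 : s ^ 2 ≤ t ^ 2 := by gcongr
  have h4 : t ^ 2 * om ψ (X * X) ≤ t ^ 2 := by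
    have := mul_le_mul_of_nonneg_left h1 (sq_nonneg t)
    linarith
  have h5 : t * om ψ (X * Y) ≤ t * t := by nlinarith
  exact le_of_mul_le_mul_left h5 ht0

theorem core {ι : Type} [Fintype ι] [DecidableEq ι] (ψ : ι → ℂ) (hψ : evnorm ψ = 1) {n : ℕ}
    (x δ : ℝ) (hx : 0 ≤ x)
    (A B : Fin n → Matrix ι ι ℂ)
    (hA : ∀ v, (A v).PosSemidef ∧ (1 - A v).PosSemidef)
    (hB : ∀ v, (B v).PosSemidef ∧ (1 - B v).PosSemidef)
    (p pt : Fin n → Fin n → Fin 2 → Fin 2 → ℝ)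
    (h00 : ∀ v w, p v w 0 0 = om ψ (A v * B w))
    (h01 : ∀ v w, p v w 0 1 = om ψ (A v * (1 - B w)))
    (h10 : ∀ v w, p v w 1 0 = om ψ ((1 - A v) * B w))
    (t01 : ∀ v, pt v v 0 1 = 0) (t10 : ∀ v, pt v v 1 0 = 0)
    (ts : ∑ v, (pt v v 0 0 + pt v v 0 1) = x)
    (tss : ∑ v, ∑ w, pt v w 0 0 = x ^ 2)
    (hdist : dist1 p pt ≤ δ) :
    (∀ v, om ψ ((A v * A v - A v) * (A v * A v - A v)) ≤ δ) ∧
    om ψ (((x : ℂ) • 1 - ∑ v, A v) * ((x : ℂ) • 1 - ∑ v, A v))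
      ≤ (n : ℝ) ^ 2 * Real.sqrt δ + (1 + 2 * x) * δ := by
  have hδ : 0 ≤ δ := le_trans (by unfold dist1; positivity) hdist
  have cell : ∀ v w, ∑ i, ∑ j, |p v w i j - pt v w i j| ≤ δ := by
    intro v w
    refine le_trans ?_ hdist
    unfold dist1
    refine le_trans ?_ (Finset.single_le_sum (f := fun v => ∑ w, ∑ i, ∑ j, |p v w i j - pt v w i j|)
      (fun _ _ => by positivity) (Finset.mem_univ v))
    exact Finset.single_le_sum (f := fun w => ∑ i, ∑ j, |p v w i j - pt v w i j|)
      (fun _ _ => by positivity) (Finset.mem_univ w)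
  have off : ∀ v, p v v 0 1 + p v v 1 0 ≤ δ := by
    intro v
    have := cell v v
    simp only [Fin.sum_univ_two, t01, t10, sub_zero] at this
    have a1 := le_abs_self (p v v 0 1)
    have a2 := le_abs_self (p v v 1 0)
    have a3 := abs_nonneg (p v v 0 0 - pt v v 0 0)
    have a4 := abs_nonneg (p v v 1 1 - pt v v 1 1)
    linarith
  have nA : ∀ v, 0 ≤ om ψ (A v) - om ψ (A v * A v) := fun v => by
    rw [← map_sub]; exact om_nonneg ψ (psd_sub_sq (hA v).1 (hA v).2)
  have nB : ∀ v, 0 ≤ om ψ (B v) - om ψ (B v * B v) := fun v => by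
    rw [← map_sub]; exact om_nonneg ψ (psd_sub_sq (hB v).1 (hB v).2)
  have sqx : ∀ v, om ψ ((A v - B v) * (A v - B v)) =
      om ψ (A v * A v) + om ψ (B v * B v) - 2 * om ψ (A v * B v) := fun v => by
    have e : (A v - B v) * (A v - B v) = A v * A v + B v * B v - A v * B v - B v * A v := by
      noncomm_ring
    rw [e, map_sub, map_sub, map_add, om_comm ψ (hB v).1.1 (hA v).1.1]; ring
  have offx : ∀ v, om ψ (A v) + om ψ (B v) - 2 * om ψ (A v * B v) ≤ δ := fun v => by
    have := off v
    rw [h01, h10, mul_sub, sub_mul, mul_one, one_mul, map_sub, map_sub] at this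
    linarith
  have dsq : ∀ v, om ψ ((A v - B v) * (A v - B v)) ≤ δ := fun v => by
    rw [sqx]; linarith [offx v, nA v, nB v]
  have dn : ∀ v, 0 ≤ om ψ ((A v - B v) * (A v - B v)) := fun v =>
    om_nonneg ψ (psd_sq ((hA v).1.1.sub (hB v).1.1))
  have A1 : ∀ v, om ψ (A v * A v) ≤ 1 := fun v => by
    have := om_nonneg ψ (hA v).2
    rw [map_sub, om_one ψ hψ] at this
    linarith [nA v]
  constructor
  · intro v
    have hC := psd_sub_sq (hA v).1 (hA v).2
    have hC' : (1 - (A v - A v * A v)).PosSemidef := by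
      have := (hA v).2.add (psd_sq (hA v).1.1)
      have e : 1 - A v + A v * A v = 1 - (A v - A v * A v) := by abel
      rwa [e] at this
    have h := om_nonneg ψ (psd_sub_sq hC hC')
    rw [map_sub, map_sub] at h
    have e : (A v * A v - A v) * (A v * A v - A v) = (A v - A v * A v) * (A v - A v * A v) := by
      noncomm_ring
    rw [e]
    have := dn v
    rw [sqx] at this
    linarith [offx v, nB v]
  · have e : om ψ (((x : ℂ) • 1 - ∑ v, A v) * ((x : ℂ) • 1 - ∑ v, A v))
        = x ^ 2 - 2 * x * ∑ v, om ψ (A v) + ∑ v, ∑ w, om ψ (A v * A w) := by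
      have : ((x : ℂ) • 1 - ∑ v, A v) * ((x : ℂ) • 1 - ∑ v, A v)
          = (x ^ 2) • (1 : Matrix ι ι ℂ) - (2 * x) • (∑ v, A v) + ∑ v, ∑ w, A v * A w := by
        have hs : ((x : ℂ) • (1 : Matrix ι ι ℂ)) = x • 1 := by
          ext i j; simp
        rw [hs, ← Finset.sum_mul_sum]
        simp only [sub_mul, mul_sub, smul_mul_assoc, mul_smul_comm, smul_sub, smul_smul, pow_two, one_mul,
          mul_one, two_mul, add_smul]
        abel
      rw [this]
      simp only [map_add, map_sub, map_smul, map_sum, smul_eq_mul, om_one ψ hψ, mul_one]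
    rw [e]
    have b1 : ∑ v, ∑ w, om ψ (A v * A w) ≤ ∑ v, ∑ w, p v w 0 0 + (n : ℝ) ^ 2 * Real.sqrt δ := by
      have : ∑ v : Fin n, ∑ w : Fin n, om ψ (A v * A w)
          ≤ ∑ v : Fin n, ∑ w : Fin n, (p v w 0 0 + Real.sqrt δ) := by
        refine Finset.sum_le_sum fun v _ => Finset.sum_le_sum fun w _ => ?_
        have := om_cs ψ (hA v).1.1 ((hA w).1.1.sub (hB w).1.1) (A1 v) (Real.sqrt_nonneg δ)
          (by rw [Real.sq_sqrt hδ]; exact dsq w)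
        rw [mul_sub, map_sub] at this
        rw [h00]; linarith
      refine this.trans (le_of_eq ?_)
      simp only [Finset.sum_add_distrib, Finset.sum_const, Finset.card_univ, Fintype.card_fin,
        nsmul_eq_mul]
      ring
    have b2 : ∑ v, ∑ w, p v w 0 0 - x ^ 2 ≤ δ := by
      rw [← tss]
      simp only [← Finset.sum_sub_distrib]
      refine le_trans ?_ hdist
      unfold dist1
      refine Finset.sum_le_sum fun v _ => Finset.sum_le_sum fun w _ => ?_
      simp only [Fin.sum_univ_two]
      have a1 := le_abs_self (p v w 0 0 - pt v w 0 0)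
      have a2 := abs_nonneg (p v w 0 1 - pt v w 0 1)
      have a3 := abs_nonneg (p v w 1 0 - pt v w 1 0)
      have a4 := abs_nonneg (p v w 1 1 - pt v w 1 1)
      linarith
    have b3 : x - ∑ v, om ψ (A v) ≤ δ := by
      rw [← ts, ← Finset.sum_sub_distrib]
      refine le_trans ?_ hdist
      unfold dist1
      refine Finset.sum_le_sum fun v _ => ?_
      refine le_trans ?_ (Finset.single_le_sum (f := fun w => ∑ i, ∑ j, |p v w i j - pt v w i j|)
        (fun _ _ => by positivity) (Finset.mem_univ v))
      have hm : om ψ (A v) = p v v 0 0 + p v v 0 1 := by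
        rw [h00, h01, ← map_add]; congr 1; noncomm_ring
      rw [hm]
      simp only [Fin.sum_univ_two]
      have a1 := neg_abs_le (p v v 0 0 - pt v v 0 0)
      have a2 := neg_abs_le (p v v 0 1 - pt v v 0 1)
      have a3 := abs_nonneg (p v v 1 0 - pt v v 1 0)
      have a4 := abs_nonneg (p v v 1 1 - pt v v 1 1)
      linarith
    have b4 := mul_le_mul_of_nonneg_left b3 hx
    nlinarith

theorem trace_rhoA {dA dB : ℕ} (ψ : Fin dA × Fin dB → ℂ) (M : Matrix (Fin dA) (Fin dA) ℂ) :
    (M * rhoA ψ).trace = pinner ((M ⊗ₖ (1 : Matrix (Fin dB) (Fin dB) ℂ)).mulVec ψ) ψ := by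
  simp only [Matrix.trace, Matrix.diag, Matrix.mul_apply, rhoA, Matrix.of_apply, pinner,
    Matrix.mulVec, dotProduct, Matrix.kroneckerMap_apply, Fintype.sum_prod_type, Matrix.one_apply,
    mul_ite, mul_one, mul_zero, ite_mul, zero_mul, Finset.sum_ite_eq, Finset.mem_univ, if_true,
    Finset.mul_sum, Finset.sum_mul]
  refine Finset.sum_congr rfl fun i _ => ?_
  rw [Finset.sum_comm]
  refine Finset.sum_congr rfl fun i _ => Finset.sum_congr rfl fun j _ => ?_
  ring

theorem trace_rhoB {dA dB : ℕ} (ψ : Fin dA × Fin dB → ℂ) (M : Matrix (Fin dB) (Fin dB) ℂ) :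
    (M * rhoB ψ).trace = pinner (((1 : Matrix (Fin dA) (Fin dA) ℂ) ⊗ₖ M).mulVec ψ) ψ := by
  simp only [Matrix.trace, Matrix.diag, Matrix.mul_apply, rhoB, Matrix.of_apply, pinner,
    Matrix.mulVec, dotProduct, Matrix.kroneckerMap_apply, Fintype.sum_prod_type_right,
    Matrix.one_apply,
    one_mul, ite_mul, zero_mul, Finset.sum_ite_eq, Finset.mem_univ, if_true,
    Finset.mul_sum, Finset.sum_mul]
  refine Finset.sum_congr rfl fun i _ => ?_
  rw [Finset.sum_comm]
  refine Finset.sum_congr rfl fun i _ => Finset.sum_congr rfl fun j _ => ?_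
  ring

theorem pinner_phid {d : ℕ} (M N : Matrix (Fin d) (Fin d) ℂ) :
    pinner ((M ⊗ₖ Nᵀ).mulVec (phid d)) (phid d) = (M * N).trace / d := by
  have hs : (((Real.sqrt d)⁻¹ : ℝ) : ℂ) * (((Real.sqrt d)⁻¹ : ℝ) : ℂ) = (d : ℂ)⁻¹ := by
    rw [← Complex.ofReal_mul, ← mul_inv, Real.mul_self_sqrt (by positivity)]
    simp
  simp only [pinner, phid, Matrix.mulVec, dotProduct, Matrix.kroneckerMap_apply,
    Fintype.sum_prod_type, mul_ite, mul_zero, Finset.sum_ite_eq, Finset.mem_univ, if_true,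
    apply_ite (starRingEnd ℂ), map_zero, Complex.conj_ofReal, Matrix.transpose_apply,
    Matrix.trace, Matrix.diag, Matrix.mul_apply, div_eq_mul_inv, ← hs, Finset.sum_mul]
  refine Finset.sum_congr rfl fun i _ => Finset.sum_congr rfl fun j _ => ?_
  ring

theorem final_bound {r K x δ : ℝ} (hδ : 0 ≤ δ)
    (h : r ≤ K * Real.sqrt δ + (1 + 2 * x) * δ) :
    Real.sqrt r ≤ Real.sqrt (K + (1 + 2 * x) * Real.sqrt δ) * δ ^ ((1 : ℝ) / 4) := by
  have e : δ ^ ((1 : ℝ) / 4) = Real.sqrt (Real.sqrt δ) := by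
    rw [Real.sqrt_eq_rpow, Real.sqrt_eq_rpow, ← Real.rpow_mul hδ]; norm_num
  rw [e, ← Real.sqrt_mul' _ (Real.sqrt_nonneg δ)]
  apply Real.sqrt_le_sqrt
  have := Real.mul_self_sqrt hδ
  calc r ≤ _ := h
    _ = K * Real.sqrt δ + (1 + 2 * x) * (Real.sqrt δ * Real.sqrt δ) := by rw [this]
    _ = _ := by ring

theorem statement12 {n b d : ℕ} (hn : 3 ≤ n) (x : ℝ) (hx : x ∈ Lambda n)
    (hd : 0 < d) (hcop : Nat.Coprime b d) (hbd : x = (b : ℝ) / d)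
    (Pt : Fin n → Matrix (Fin d) (Fin d) ℂ)
    (hPt : ∀ v, IsProjection (Pt v)) (hPtsum : ∑ v, Pt v = (x : ℂ) • 1)
    (δ : ℝ) (hδ : 0 ≤ δ)
    {dA dB : ℕ} (ψ : Fin dA × Fin dB → ℂ)
    (E : Fin n → Matrix (Fin dA) (Fin dA) ℂ)
    (F : Fin n → Matrix (Fin dB) (Fin dB) ℂ)
    (hψ : evnorm ψ = 1)
    (hE : ∀ v, (E v).PosSemidef ∧ (1 - E v).PosSemidef)
    (hF : ∀ w, (F w).PosSemidef ∧ (1 - F w).PosSemidef)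
    (p pt : Fin n → Fin n → Fin 2 → Fin 2 → ℝ)
    (hp : ∀ v w i j, (p v w i j : ℂ) =
      pinner ((canonPair (E v) i ⊗ₖ canonPair (F w) j).mulVec ψ) ψ)
    (hpt : ∀ v w i j, (pt v w i j : ℂ) =
      pinner ((canonPair (Pt v) i ⊗ₖ canonPair ((Pt w)ᵀ) j).mulVec (phid d)) (phid d))
    (hdist : dist1 p pt ≤ δ) :
    (∀ v, rnorm (rhoA ψ) (E v * E v - E v)
      ≤ Real.sqrt ((n : ℝ) ^ 2 + (1 + 2 * x) * Real.sqrt δ) * δ ^ ((1 : ℝ) / 4)) ∧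
    rnorm (rhoA ψ) ((x : ℂ) • 1 - ∑ v, E v)
      ≤ Real.sqrt ((n : ℝ) ^ 2 + (1 + 2 * x) * Real.sqrt δ) * δ ^ ((1 : ℝ) / 4) ∧
    (∀ w, rnorm (rhoB ψ) (F w * F w - F w)
      ≤ Real.sqrt ((n : ℝ) ^ 2 + (1 + 2 * x) * Real.sqrt δ) * δ ^ ((1 : ℝ) / 4)) ∧
    rnorm (rhoB ψ) ((x : ℂ) • 1 - ∑ w, F w)
      ≤ Real.sqrt ((n : ℝ) ^ 2 + (1 + 2 * x) * Real.sqrt δ) * δ ^ ((1 : ℝ) / 4) := by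
  have hx0 : 0 ≤ x := by rw [hbd]; positivity
  have hdC : (d : ℂ) ≠ 0 := by exact_mod_cast hd.ne'
  -- canonical correlation
  have q00 : ∀ v w, (pt v w 0 0 : ℂ) = (Pt v * Pt w).trace / d := fun v w => by
    rw [hpt, ← pinner_phid]; simp [canonPair]
  have q01 : ∀ v w, (pt v w 0 1 : ℂ) = (Pt v * (1 - Pt w)).trace / d := fun v w => by
    rw [hpt, ← pinner_phid]; simp [canonPair]
  have q10 : ∀ v w, (pt v w 1 0 : ℂ) = ((1 - Pt v) * Pt w).trace / d := fun v w => by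
    rw [hpt, ← pinner_phid]; simp [canonPair]
  have t01 : ∀ v, pt v v 0 1 = 0 := fun v => by
    have := q01 v v
    rw [mul_sub, mul_one, (hPt v).2, sub_self] at this
    simpa using this
  have t10 : ∀ v, pt v v 1 0 = 0 := fun v => by
    have := q10 v v
    rw [sub_mul, one_mul, (hPt v).2, sub_self] at this
    simpa using this
  have ts : ∑ v, pt v v 0 0 = x := by
    have : ((∑ v, pt v v 0 0 : ℝ) : ℂ) = (x : ℂ) := by
      push_cast
      simp only [q00, (hPt _).2]
      rw [← Finset.sum_div, ← Matrix.trace_sum, hPtsum]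
      simp [hdC]
    exact_mod_cast this
  have tss : ∑ v, ∑ w, pt v w 0 0 = x ^ 2 := by
    have : ((∑ v, ∑ w, pt v w 0 0 : ℝ) : ℂ) = ((x ^ 2 : ℝ) : ℂ) := by
      push_cast
      simp only [q00]
      simp only [← Finset.sum_div, ← Matrix.trace_sum, ← Finset.sum_mul_sum, hPtsum]
      simp only [Matrix.smul_mul, one_mul, smul_smul, Matrix.trace_smul, Matrix.trace_one,
        Fintype.card_fin, smul_eq_mul]
      field_simp
    exact_mod_cast this
  let A : Fin n → Matrix (Fin dA × Fin dB) (Fin dA × Fin dB) ℂ := fun v => E v ⊗ₖ 1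
  let B : Fin n → Matrix (Fin dA × Fin dB) (Fin dA × Fin dB) ℂ := fun w => 1 ⊗ₖ F w
  have sA : ∀ X Y : Matrix (Fin dA) (Fin dA) ℂ,
      (X - Y) ⊗ₖ (1 : Matrix (Fin dB) (Fin dB) ℂ) = X ⊗ₖ 1 - Y ⊗ₖ 1 := fun X Y => by
    ext; simp [sub_mul]
  have sB : ∀ X Y : Matrix (Fin dB) (Fin dB) ℂ,
      (1 : Matrix (Fin dA) (Fin dA) ℂ) ⊗ₖ (X - Y) = 1 ⊗ₖ X - 1 ⊗ₖ Y := fun X Y => by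
    ext; simp [mul_sub]
  have mA : ∀ X Y : Matrix (Fin dA) (Fin dA) ℂ,
      (X * Y) ⊗ₖ (1 : Matrix (Fin dB) (Fin dB) ℂ) = X ⊗ₖ 1 * Y ⊗ₖ 1 := fun X Y => by
    rw [← Matrix.mul_kronecker_mul, one_mul]
  have mB : ∀ X Y : Matrix (Fin dB) (Fin dB) ℂ,
      (1 : Matrix (Fin dA) (Fin dA) ℂ) ⊗ₖ (X * Y) = 1 ⊗ₖ X * 1 ⊗ₖ Y := fun X Y => by
    rw [← Matrix.mul_kronecker_mul, one_mul]
  have A' : ∀ v, 1 - A v = (1 - E v) ⊗ₖ 1 := fun v => by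
    rw [sA, Matrix.one_kronecker_one]
  have B' : ∀ v, 1 - B v = 1 ⊗ₖ (1 - F v) := fun v => by
    rw [sB, Matrix.one_kronecker_one]
  have cm : ∀ X Y, (X ⊗ₖ (1 : Matrix (Fin dB) (Fin dB) ℂ)) * ((1 : Matrix (Fin dA) (Fin dA) ℂ) ⊗ₖ Y)
      = X ⊗ₖ Y := fun X Y => by rw [← Matrix.mul_kronecker_mul, one_mul, mul_one]
  have cm' : ∀ X Y, ((1 : Matrix (Fin dA) (Fin dA) ℂ) ⊗ₖ Y) * (X ⊗ₖ (1 : Matrix (Fin dB) (Fin dB) ℂ))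
      = X ⊗ₖ Y := fun X Y => by rw [← Matrix.mul_kronecker_mul, one_mul, mul_one]
  have hA : ∀ v, (A v).PosSemidef ∧ (1 - A v).PosSemidef := fun v => by
    rw [A']
    exact ⟨(hE v).1.kronecker Matrix.PosSemidef.one, (hE v).2.kronecker Matrix.PosSemidef.one⟩
  have hB : ∀ v, (B v).PosSemidef ∧ (1 - B v).PosSemidef := fun v => by
    rw [B']
    exact ⟨Matrix.PosSemidef.one.kronecker (hF v).1, Matrix.PosSemidef.one.kronecker (hF v).2⟩
  have hp' : ∀ v w i j, p v w i j = om ψ (canonPair (E v) i ⊗ₖ canonPair (F w) j) :=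
    fun v w i j => by rw [om_apply, ← hp, Complex.ofReal_re]
  obtain ⟨a1, a2⟩ := core ψ hψ x δ hx0 A B hA hB p pt
    (fun v w => by rw [hp', cm]; simp [canonPair])
    (fun v w => by rw [hp', B', cm]; simp [canonPair])
    (fun v w => by rw [hp', A', cm]; simp [canonPair])
    t01 t10 (by simpa [t01] using ts) tss hdist
  obtain ⟨b1, b2⟩ := core ψ hψ x δ hx0 B A hB hA (fun v w i j => p w v j i)
    (fun v w i j => pt w v j i)
    (fun v w => by rw [hp', cm']; simp [canonPair])
    (fun v w => by rw [hp', A', cm']; simp [canonPair])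
    (fun v w => by rw [hp', B', cm']; simp [canonPair])
    t10 t01 (by simpa [t10] using ts) (by rw [Finset.sum_comm]; exact tss)
    (by
      refine le_trans (le_of_eq ?_) hdist
      unfold dist1
      rw [Finset.sum_comm]
      refine Finset.sum_congr rfl fun v _ => Finset.sum_congr rfl fun w _ => ?_
      rw [Finset.sum_comm])
  have weak : ∀ r : ℝ, r ≤ δ → r ≤ (n : ℝ) ^ 2 * Real.sqrt δ + (1 + 2 * x) * δ := fun r hr => by
    have := mul_nonneg hx0 hδ
    have h2 : 0 ≤ (n : ℝ) ^ 2 * Real.sqrt δ := by positivity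
    linarith
  have sumA : (∑ v, E v) ⊗ₖ (1 : Matrix (Fin dB) (Fin dB) ℂ) = ∑ v, A v := by
    ext; simp [A, Matrix.sum_apply, Finset.sum_mul]
  have sumB : (1 : Matrix (Fin dA) (Fin dA) ℂ) ⊗ₖ (∑ v, F v) = ∑ v, B v := by
    ext; simp [B, Matrix.sum_apply, Finset.mul_sum]
  have hxH : ∀ k : ℕ, ((x : ℂ) • (1 : Matrix (Fin k) (Fin k) ℂ)).IsHermitian := fun k => by
    rw [Matrix.IsHermitian, Matrix.conjTranspose_smul]; simp
  have sqH : ∀ {k : ℕ} {M : Matrix (Fin k) (Fin k) ℂ}, M.IsHermitian → (M * M).IsHermitian :=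
    fun {k M} h => by rw [Matrix.IsHermitian, Matrix.conjTranspose_mul, h.eq]
  have sumH : ∀ {k : ℕ} (G : Fin n → Matrix (Fin k) (Fin k) ℂ), (∀ v, (G v).IsHermitian) →
      (∑ v, G v).IsHermitian := fun {k} G h => by
    rw [Matrix.IsHermitian, Matrix.conjTranspose_sum]
    exact Finset.sum_congr rfl fun v _ => h v
  have rA : ∀ X : Matrix (Fin dA) (Fin dA) ℂ, X.IsHermitian →
      rnorm (rhoA ψ) X = Real.sqrt (om ψ (X ⊗ₖ 1 * X ⊗ₖ 1)) := fun X hX => by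
    rw [rnorm, trace_rhoA, ← om_apply, hX.eq, mA]
  have rB : ∀ X : Matrix (Fin dB) (Fin dB) ℂ, X.IsHermitian →
      rnorm (rhoB ψ) X = Real.sqrt (om ψ (1 ⊗ₖ X * 1 ⊗ₖ X)) := fun X hX => by
    rw [rnorm, trace_rhoB, ← om_apply, hX.eq, mB]
  refine ⟨fun v => ?_, ?_, fun v => ?_, ?_⟩
  · rw [rA _ ((sqH (hE v).1.1).sub (hE v).1.1), sA, mA]
    exact final_bound hδ (weak _ (a1 v))
  · rw [rA _ ((hxH _).sub (sumH E fun v => (hE v).1.1)), sA, Matrix.smul_kronecker,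
      Matrix.one_kronecker_one, sumA]
    exact final_bound hδ a2
  · rw [rB _ ((sqH (hF v).1.1).sub (hF v).1.1), sB, mB]
    exact final_bound hδ (weak _ (b1 v))
  · rw [rB _ ((hxH _).sub (sumH F fun v => (hF v).1.1)), sB, Matrix.kronecker_smul,
      Matrix.one_kronecker_one, sumB]
    exact final_bound hδ b2

end QST
end
end

section
/- Let n ≥ 3 and x ∈ Λ_n with x = b/d in lowest terms, and let P̃_1, …, P̃_n ∈ M_d(ℂ) be projections with Σ_v P̃_v = x·I_d. Then for every ε > 0 there exist δ > 0 and m ∈ ℕ with the following property: for every r ∈ ℕ, every density matrix ρ ∈ M_r(ℂ), and all positive semidefinite contractions E_1, …, E_n ∈ M_r(ℂ) satisfying (a) ‖E_v² − E_v‖_ρ ≤ δ for all v ∈ [n], (b) ‖x·I_r − Σ_{v=1}^n E_v‖_ρ ≤ δ, and (c) |tr((W_1 W_2 − W_2 W_1)ρ)| ≤ δ for all monomials W_1, W_2 of degree at most m in the matrices E_1, …, E_n, there exist s ∈ ℕ and an isometry V : ℂ^r → ℂ^d ⊗ ℂ^s such that ‖E_v − V*(P̃_v ⊗ I_s)V‖_ρ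 ≤ ε for all v ∈ [n]. -/
open scoped Matrix Kronecker ComplexOrder

noncomputable section
namespace QST

def Rl (A : Type) [Ring A] [StarRing A] : Prop :=
  ∀ (ι : Type) [Fintype ι] (a : ι → A), ∑ i, star (a i) * a i = 0 → ∀ i, a i = 0

lemma Rl.matrix {A : Type} [Ring A] [StarRing A] (h : Rl A) (κ : Type) [Fintype κ]
    [DecidableEq κ] : Rl (Matrix κ κ A) := by
  intro ι _ X hX i
  ext k j
  have h1 : ∑ q : ι × κ, star (X q.1 q.2 j) * X q.1 q.2 j = 0 := by
    have := congrFun (congrFun hX j) j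
    rw [Fintype.sum_prod_type]
    simpa [Matrix.sum_apply, Matrix.mul_apply, Matrix.star_apply] using this
  exact h (ι × κ) (fun q => X q.1 q.2 j) h1 (i, k)

def FD (n : ℕ) (x : ℝ) : Prop :=
  ∀ (A : Type) [Ring A] [StarRing A] [Algebra ℂ A] [StarModule ℂ A], Rl A →
    ∀ (e : A) (p : Fin n → A), star e = e → e * e = e →
      (∀ v, star (p v) = p v ∧ p v * p v = p v ∧ e * p v = p v ∧ p v * e = p v) →
      ∑ v, p v = (x : ℂ) • e →
      ∃ W : Submodule ℂ A, FiniteDimensional ℂ W ∧ e ∈ W ∧ (∀ w ∈ W, e * w = w) ∧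
        ∀ v, ∀ w ∈ W, p v * w ∈ W

lemma FD_zero (n : ℕ) : FD n 0 := by
  intro A _ _ _ _ hA e p he hee hp hs
  have h0 : ∀ v, p v = 0 := by
    apply hA (Fin n) p
    rw [← (by simpa using hs : ∑ v, p v = 0)]
    exact Finset.sum_congr rfl fun v _ => by rw [(hp v).1, (hp v).2.1]
  refine ⟨Submodule.span ℂ {e}, inferInstance, Submodule.mem_span_singleton_self e, ?_, ?_⟩
  · intro w hw
    obtain ⟨c, rfl⟩ := Submodule.mem_span_singleton.1 hw
    rw [mul_smul_comm, hee]
  · intro v w _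
    rw [h0, zero_mul]; exact zero_mem _

lemma FD_step (n : ℕ) (x y : ℝ) (hx0 : x ≠ 0) (hx1 : x ≠ 1) (hxy : y = n - x / (x - 1))
    (hy : FD n y) : FD n x := by
  intro A _ _ _ _ hA e p he hee hp hs
  have hps : ∀ v, star (p v) = p v := fun v => (hp v).1
  have hpp : ∀ v, p v * p v = p v := fun v => (hp v).2.1
  have hep : ∀ v, e * p v = p v := fun v => (hp v).2.2.1
  have hpe : ∀ v, p v * e = p v := fun v => (hp v).2.2.2
  have hx0' : (x : ℂ) ≠ 0 := by exact_mod_cast hx0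
  have hx1' : (x : ℂ) - 1 ≠ 0 := by
    rw [sub_ne_zero]; exact_mod_cast hx1
  let D : Matrix (Fin n) (Fin n) A := Matrix.diagonal p
  let G : Matrix (Fin n) (Fin n) A := Matrix.of fun i j => p i * p j
  let R : Fin n → Matrix (Fin n) (Fin n) A := fun v => Matrix.single v v (p v)
  let f : Matrix (Fin n) (Fin n) A := D - (x : ℂ)⁻¹ • G
  have hDD : D * D = D := by
    simp only [D, Matrix.diagonal_mul_diagonal, hpp]
  have hDG : D * G = G := by
    ext i j; simp [D, G, ← mul_assoc, hpp]
  have hGD : G * D = G := by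
    ext i j; simp [D, G, mul_assoc, hpp]
  have hGG : G * G = (x : ℂ) • G := by
    ext i j
    have : ∀ k, p i * p k * (p k * p j) = p i * p k * p j := fun k => by
      rw [mul_assoc, ← mul_assoc (p k), hpp, mul_assoc]
    simp only [G, Matrix.mul_apply, Matrix.of_apply, Matrix.smul_apply, this]
    rw [← Finset.sum_mul, ← Finset.mul_sum, hs, mul_smul_comm, hpe, smul_mul_assoc]
  have hff : f * f = f := by
    simp only [f, sub_mul, mul_sub, hDD, smul_mul_assoc, mul_smul_comm, hDG, hGD, hGG, smul_smul]
    rw [inv_mul_cancel₀ hx0', one_smul, sub_self, smul_zero, sub_zero]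
  have hfs : star f = f := by
    ext i j
    simp only [f, D, G, Matrix.star_apply, Matrix.sub_apply, Matrix.smul_apply, Matrix.of_apply,
      star_sub, star_smul, star_mul, hps]
    congr 1
    · by_cases h : i = j
      · subst h; simp [hps]
      · rw [Matrix.diagonal_apply_ne _ h, Matrix.diagonal_apply_ne _ (Ne.symm h), star_zero]
    · simp
  have hRfR : ∀ v, R v * f * R v = (1 - (x : ℂ)⁻¹) • R v := by
    intro v
    have : f v v = (1 - (x : ℂ)⁻¹) • p v := by
      simp [f, D, G, hpp, sub_smul]
    simp only [R, Matrix.single_mul_mul_single, this, Matrix.smul_single, smul_mul_assoc, mul_smul_comm, hpp]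
  have hRs : ∀ v, star (R v) = R v := by
    intro v
    simp [R, Matrix.star_eq_conjTranspose, Matrix.conjTranspose_single, hps]
  have hRD : ∑ v, R v = D := by
    ext i j
    simp [R, D, Matrix.sum_apply, Matrix.diagonal_apply, Matrix.single_apply]
    by_cases h : i = j
    · subst h; simp
    · simp [h]
      apply Finset.sum_eq_zero; intro c _
      rw [if_neg]; rintro ⟨rfl, rfl⟩; exact h rfl
  have hfDf : f * D * f = f := by
    have : f * D = f := by
      simp only [f, sub_mul, hDD, smul_mul_assoc, hGD]
    rw [this, hff]
  let c : ℂ := x / (x - 1)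
  let q : Fin n → Matrix (Fin n) (Fin n) A := fun v => f - c • (f * R v * f)
  have hfh : ∀ v, f * (f * R v * f) = f * R v * f := fun v => by
    rw [← mul_assoc, ← mul_assoc, hff]
  have hhf : ∀ v, (f * R v * f) * f = f * R v * f := fun v => by
    rw [mul_assoc, hff]
  have hhh : ∀ v, (f * R v * f) * (f * R v * f) = (1 - (x : ℂ)⁻¹) • (f * R v * f) := fun v => by
    calc (f * R v * f) * (f * R v * f) = f * (R v * (f * f) * R v) * f := by noncomm_ring
      _ = _ := by rw [hff, hRfR]; simp only [mul_smul_comm, smul_mul_assoc]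
  obtain ⟨W, hWf, hfW, hfw, hqW⟩ := hy (Matrix (Fin n) (Fin n) A) (hA.matrix (Fin n)) f q hfs hff
    (by
      intro v
      refine ⟨?_, ?_, ?_, ?_⟩
      · simp only [q, star_sub, star_smul, star_mul, hfs, hRs, c]
        simp [mul_assoc]
      · simp only [q, sub_mul, mul_sub, hff, smul_mul_assoc, mul_smul_comm, hfh, hhf, hhh, smul_smul]
        rw [show c * 1 - c * (x : ℂ)⁻¹ = 1 by simp only [c]; field_simp, one_smul, sub_self,
          smul_zero, sub_zero]
      · simp only [q, mul_sub, hff, mul_smul_comm, hfh]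
      · simp only [q, sub_mul, hff, smul_mul_assoc, hhf])
    (by
      simp only [q, Finset.sum_sub_distrib, ← Finset.smul_sum, ← Finset.sum_mul, ← Finset.mul_sum,
        hRD, hfDf]
      simp only [Finset.sum_const, Finset.card_univ, Fintype.card_fin, hxy, c]
      rw [← Nat.cast_smul_eq_nsmul ℂ, ← sub_smul]
      push_cast; rfl)
  have hc : c ≠ 0 := div_ne_zero hx0' hx1'
  have hhW : ∀ v, ∀ w ∈ W, f * R v * w ∈ W := by
    intro v w hw
    have h1 : f * R v * w = c⁻¹ • (w - q v * w) := by
      simp only [q, sub_mul, hfw w hw, sub_sub_cancel, smul_mul_assoc, smul_smul, inv_mul_cancel₀ hc, one_smul]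
      rw [mul_assoc (f * R v), hfw w hw]
    rw [h1]
    exact W.smul_mem _ (W.sub_mem hw (hqW v w hw))
  let ent : Fin n → Fin n → (Matrix (Fin n) (Fin n) A →ₗ[ℂ] A) := fun i j =>
    { toFun := fun w => p i * w i j * p j
      map_add' := fun a b => by simp [mul_add, add_mul]
      map_smul' := fun a b => by simp }
  have hkey : ∀ v i j w, v ≠ i → p v * (p i * w i j * p j) = (-(x : ℂ)) • ent v j (f * R i * w) := by
    intro v i j w hvi
    have : (f * R i * w) v j = -(x : ℂ)⁻¹ • (p v * p i * w i j) := by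
      rw [mul_assoc, Matrix.mul_apply, Finset.sum_eq_single i]
      · have : (R i * w) i j = p i * w i j := by simp [R]
        rw [this]
        simp only [f, D, G, Matrix.sub_apply, Matrix.diagonal_apply_ne _ hvi, Matrix.smul_apply,
          Matrix.of_apply, zero_sub, neg_mul, smul_mul_assoc, neg_smul]
        congr 2
        rw [mul_assoc (p v), ← mul_assoc (p i) (p i), hpp, ← mul_assoc]
      · intro k _ hk
        have : (R i * w) k j = 0 := by simp [R, Matrix.single_mul_apply_of_ne, hk]
        rw [this, mul_zero]
      · simp
    simp only [ent, LinearMap.coe_mk, AddHom.coe_mk, this]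
    simp only [mul_smul_comm, smul_mul_assoc, smul_smul]
    rw [neg_mul_neg, mul_inv_cancel₀ hx0', one_smul]
    simp only [← mul_assoc, hpp]
  let W1 : Submodule ℂ A := Submodule.span ℂ (insert e (Set.range p))
  let W2 : Submodule ℂ A := ⨆ q : Fin n × Fin n, W.map (ent q.1 q.2)
  have hW2 : ∀ i j w, w ∈ W → p i * w i j * p j ∈ W2 := fun i j w hw =>
    Submodule.mem_iSup_of_mem (p := fun q : Fin n × Fin n => W.map (ent q.1 q.2)) (i, j)
      ⟨w, hw, rfl⟩
  have hind : ∀ (U : Submodule ℂ A), e ∈ U → (∀ v, p v ∈ U) →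
      (∀ i j, ∀ w ∈ W, p i * w i j * p j ∈ U) → W1 ⊔ W2 ≤ U := by
    intro U h1 h2 h3
    refine sup_le (Submodule.span_le.2 ?_) (iSup_le ?_)
    · rintro _ (rfl | ⟨v, rfl⟩)
      · exact h1
      · exact h2 v
    · rintro ⟨i, j⟩ _ ⟨w, hw, rfl⟩
      exact h3 i j w hw
  have he1 : e ∈ W1 ⊔ W2 := Submodule.mem_sup_left (Submodule.subset_span (Set.mem_insert _ _))
  have hp1 : ∀ v, p v ∈ W1 ⊔ W2 := fun v =>
    Submodule.mem_sup_left (Submodule.subset_span (Set.mem_insert_of_mem _ ⟨v, rfl⟩))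
  refine ⟨W1 ⊔ W2, ?_, he1, ?_, ?_⟩
  · have : FiniteDimensional ℂ W1 := FiniteDimensional.span_of_finite ℂ ((Set.finite_range p).insert e)
    infer_instance
  · intro w hw
    have := hind (LinearMap.eqLocus (LinearMap.mulLeft ℂ e) LinearMap.id) (by simp [hee])
      (by simp [hep]) (by intro i j w _; simp [← mul_assoc, hep]) hw
    simpa using this
  · intro v w hw
    have := hind ((W1 ⊔ W2).comap (LinearMap.mulLeft ℂ (p v))) (by simpa [hpe] using hp1 v)
      ?_ ?_ hw
    · simpa using this
    · intro i
      simp only [Submodule.mem_comap, LinearMap.mulLeft_apply]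
      by_cases h : v = i
      · subst h; rw [hpp]; exact hp1 v
      · have : p v * p i = (-(x : ℂ)) • (p v * f v i * p i) := by
          simp only [f, D, G, Matrix.sub_apply, Matrix.diagonal_apply_ne _ h, Matrix.smul_apply,
            Matrix.of_apply, zero_sub, mul_neg, neg_mul, smul_mul_assoc, mul_smul_comm, ← mul_assoc, hpp]
          rw [mul_assoc, hpp]
          simp [smul_smul, hx0']
        rw [this]
        exact Submodule.smul_mem _ _ (Submodule.mem_sup_right (hW2 v i f hfW))
    · intro i j w hw
      simp only [Submodule.mem_comap, LinearMap.mulLeft_apply]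
      by_cases h : v = i
      · subst h; rw [← mul_assoc, ← mul_assoc, hpp]; exact Submodule.mem_sup_right (hW2 v j w hw)
      · rw [hkey v i j w h]
        exact Submodule.smul_mem _ _ (Submodule.mem_sup_right (hW2 v j _ (hhW i w hw)))


lemma trace_idem {M : Type} [AddCommGroup M] [Module ℂ M] [FiniteDimensional ℂ M]
    (f : M →ₗ[ℂ] M) (hf : f * f = f) :
    LinearMap.trace ℂ M f = (Module.finrank ℂ (LinearMap.range f) : ℂ) := by
  have : IsIdempotentElem f := hf
  exact (LinearMap.IsIdempotentElem.isProj_range f this).trace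

lemma ker_bound {M : Type} [AddCommGroup M] [Module ℂ M] [FiniteDimensional ℂ M] {n : ℕ}
    (f : Fin n → (M →ₗ[ℂ] M)) :
    Module.finrank ℂ M ≤ Module.finrank ℂ (⨅ v, LinearMap.ker (f v) : Submodule ℂ M) +
      ∑ v, Module.finrank ℂ (LinearMap.range (f v)) := by
  let Ψ : M →ₗ[ℂ] ((v : Fin n) → LinearMap.range (f v)) := LinearMap.pi fun v => (f v).rangeRestrict
  have h1 := LinearMap.finrank_range_add_finrank_ker Ψ
  have h2 : LinearMap.ker Ψ = ⨅ v, LinearMap.ker (f v) := by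
    simp only [Ψ, LinearMap.ker_pi, LinearMap.ker_rangeRestrict]
  have h3 : Module.finrank ℂ (LinearMap.range Ψ) ≤ ∑ v, Module.finrank ℂ (LinearMap.range (f v)) := by
    refine (Submodule.finrank_le _).trans ?_
    rw [Module.finrank_pi_fintype]
  rw [h2] at h1
  omega

lemma trace_mat_idem {ι : Type} [Fintype ι] [DecidableEq ι] (X : Matrix ι ι ℂ) (hX : X * X = X) :
    X.trace = (Module.finrank ℂ (LinearMap.range (Matrix.toLin' X)) : ℂ) := by
  rw [← Matrix.trace_toLin'_eq, trace_idem]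
  rw [Module.End.mul_eq_comp, ← Matrix.toLin'_mul, hX]

def KK {n d D : ℕ} (T : Fin n → Matrix (Fin D) (Fin D) ℂ) (P : Fin n → Matrix (Fin d) (Fin d) ℂ) :
    Submodule ℂ (Fin d × Fin D → ℂ) :=
  ⨅ v, LinearMap.ker (Matrix.toLin' ((P v)ᵀ ⊗ₖ (1 - T v)))

lemma mem_KK {n d D : ℕ} (T : Fin n → Matrix (Fin D) (Fin D) ℂ)
    (P : Fin n → Matrix (Fin d) (Fin d) ℂ) (Z : Matrix (Fin D) (Fin d) ℂ) :
    Matrix.vec Z ∈ KK T P ↔ ∀ v, (1 - T v) * Z * P v = 0 := by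
  simp only [KK, Submodule.mem_iInf, LinearMap.mem_ker, Matrix.toLin'_apply,
    Matrix.kronecker_mulVec_vec, Matrix.transpose_transpose, Matrix.vec_eq_zero_iff]

lemma KK_dim {n d D : ℕ} (T : Fin n → Matrix (Fin D) (Fin D) ℂ)
    (P : Fin n → Matrix (Fin d) (Fin d) ℂ) (hT : ∀ v, T v * T v = T v) (hP : ∀ v, P v * P v = P v)
    (kT kP : Fin n → ℝ) (hkT : ∀ v, (T v).trace = (kT v : ℂ)) (hkP : ∀ v, (P v).trace = (kP v : ℂ)) :
    (d : ℝ) * D ≤ Module.finrank ℂ (KK T P) + ∑ v, kP v * (D - kT v) := by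
  have h := ker_bound (fun v => Matrix.toLin' ((P v)ᵀ ⊗ₖ (1 - T v)))
  have h2 : ∀ v, (Module.finrank ℂ (LinearMap.range (Matrix.toLin' ((P v)ᵀ ⊗ₖ (1 - T v)))) : ℝ)
      = kP v * (D - kT v) := by
    intro v
    have := trace_mat_idem ((P v)ᵀ ⊗ₖ (1 - T v)) (by
      rw [← Matrix.mul_kronecker_mul, ← Matrix.transpose_mul, hP]
      congr 1
      simp [sub_mul, mul_sub, hT])
    rw [Matrix.trace_kronecker, Matrix.trace_transpose, hkP, Matrix.trace_sub, hkT,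
      Matrix.trace_one] at this
    have h3 : ((Module.finrank ℂ (LinearMap.range (Matrix.toLin' ((P v)ᵀ ⊗ₖ (1 - T v)))) : ℝ) : ℂ)
      = ((kP v * (D - kT v) : ℝ) : ℂ) := by
      push_cast; rw [← this]; simp
    exact_mod_cast h3
  have h5 : Module.finrank ℂ (Fin d × Fin D → ℂ) = d * D := by simp
  rw [h5] at h
  have h4 : ((d * D : ℕ) : ℝ) ≤ _ := Nat.cast_le.2 h
  push_cast at h4
  simp only [h2] at h4
  exact h4

/-- Irreducibility from lowest terms. -/
lemma irred {n b d : ℕ} (hd : 0 < d) (hcop : Nat.Coprime b d) (x : ℝ) (hbd : x = (b : ℝ) / d)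
    (P : Fin n → Matrix (Fin d) (Fin d) ℂ) (hP : ∀ v, P v * P v = P v)
    (hsum : ∑ v, P v = (x : ℂ) • 1) (U : Submodule ℂ (Fin d → ℂ))
    (hU : ∀ v, ∀ u ∈ U, P v *ᵥ u ∈ U) : U = ⊥ ∨ U = ⊤ := by
  let T : Fin n → (U →ₗ[ℂ] U) := fun v => (Matrix.toLin' (P v)).restrict (p := U) (q := U) (by
    intro u hu; simpa using hU v u hu)
  have hT : ∀ v, T v * T v = T v := by
    intro v
    ext u : 2
    simp [T, LinearMap.restrict_apply, Matrix.mulVec_mulVec, hP]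
  have hs : ∑ v, T v = (x : ℂ) • LinearMap.id := by
    ext u : 2
    have := congrArg (fun X => X *ᵥ (u : Fin d → ℂ)) hsum
    simpa [T, LinearMap.sum_apply, LinearMap.restrict_apply, Matrix.sum_mulVec, Matrix.smul_mulVec] using this
  have ht := congrArg (LinearMap.trace ℂ U) hs
  rw [map_sum, map_smul, LinearMap.trace_id] at ht
  simp only [trace_idem _ (hT _)] at ht
  rw [← Nat.cast_sum] at ht
  set N := ∑ v, Module.finrank ℂ (LinearMap.range (T v))
  set u := Module.finrank ℂ U with hu
  have hd' : (d : ℝ) ≠ 0 := by positivity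
  have h1 : (N : ℝ) = x * u := by
    have : ((N : ℝ) : ℂ) = ((x * u : ℝ) : ℂ) := by push_cast; simpa using ht
    exact_mod_cast this
  have h2 : N * d = b * u := by
    have : (N : ℝ) * d = b * u := by rw [h1, hbd]; field_simp
    exact_mod_cast this
  have h3 : d ∣ u := (Nat.Coprime.dvd_mul_left hcop.symm).1 ⟨N, by rw [← h2, mul_comm]⟩
  have h4 : u ≤ d := by simpa using Submodule.finrank_le U
  rcases Nat.eq_zero_or_pos u with h0 | h0
  · left; exact Submodule.finrank_eq_zero.1 h0
  · right
    apply Submodule.eq_top_of_finrank_eq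
    have := Nat.le_of_dvd h0 h3
    simp; omega

lemma scalar_of_comm {n b d : ℕ} (hd : 0 < d) (hcop : Nat.Coprime b d) (x : ℝ)
    (hbd : x = (b : ℝ) / d)
    (P : Fin n → Matrix (Fin d) (Fin d) ℂ) (hP : ∀ v, P v * P v = P v)
    (hsum : ∑ v, P v = (x : ℂ) • 1) (X : Matrix (Fin d) (Fin d) ℂ)
    (hX : ∀ v, X * P v = P v * X) : ∃ c : ℂ, X = c • 1 := by
  have : Nonempty (Fin d) := ⟨⟨0, hd⟩⟩
  obtain ⟨c, hc⟩ := Module.End.exists_eigenvalue (Matrix.toLin' X)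
  refine ⟨c, ?_⟩
  rcases irred hd hcop x hbd P hP hsum (Module.End.eigenspace (Matrix.toLin' X) c) (by
    intro v u hu
    rw [Module.End.mem_eigenspace_iff, Matrix.toLin'_apply] at hu ⊢
    rw [Matrix.mulVec_mulVec, hX, ← Matrix.mulVec_mulVec, hu, Matrix.mulVec_smul]) with h | h
  · exact absurd h hc
  · ext j i
    have : Pi.single i (1:ℂ) ∈ Module.End.eigenspace (Matrix.toLin' X) c := by rw [h]; trivial
    rw [Module.End.mem_eigenspace_iff] at this
    have := congrFun this j
    simpa [Matrix.one_apply, Pi.single_apply] using this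

lemma sum_smul_comm' {A : Type} [Ring A] [Algebra ℂ A] {d : ℕ} (P : Matrix (Fin d) (Fin d) ℂ)
    (s z : Fin d → A) :
    ∑ j, s j * ∑ i, P i j • z i = ∑ i, ∑ j, P i j • (s j * z i) := by
  rw [Finset.sum_comm]
  refine Finset.sum_congr rfl fun j _ => ?_
  rw [Finset.mul_sum]
  exact Finset.sum_congr rfl fun i _ => by rw [mul_smul_comm]

lemma intertwine {A : Type} [Ring A] [StarRing A] [Algebra ℂ A] [StarModule ℂ A] (hA : Rl A)
    {n d : ℕ} {x : ℝ} (p : Fin n → A) (hps : ∀ v, star (p v) = p v) (hpp : ∀ v, p v * p v = p v)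
    (hsp : ∑ v, p v = (x : ℂ) • 1)
    (P : Fin n → Matrix (Fin d) (Fin d) ℂ) (hPs : ∀ v, (P v)ᴴ = P v) (hPP : ∀ v, P v * P v = P v)
    (hsP : ∑ v, P v = (x : ℂ) • 1) (z : Fin d → A)
    (h : ∀ v j, p v * ∑ i, P v i j • z i = ∑ i, P v i j • z i) :
    ∀ v j, p v * z j = ∑ i, P v i j • z i := by
  let u : Fin n → Fin d → A := fun v j => ∑ i, P v i j • z i
  have hPc : ∀ v i j, star (P v i j) = P v j i := fun v i j => by
    conv_rhs => rw [← hPs v]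
    rfl
  have hu : ∀ v j, star (u v j) = ∑ i, P v j i • star (z i) := fun v j => by
    simp only [u, star_sum, star_smul, hPc]
  have e1 : ∀ v, ∑ j, star (u v j) * z j = ∑ j, star (z j) * u v j := fun v => by
    simp only [hu, u, Finset.sum_mul, Finset.mul_sum, smul_mul_assoc, mul_smul_comm]
    rw [Finset.sum_comm]
  have e2 : ∀ v, ∑ j, star (u v j) * u v j = ∑ j, star (z j) * u v j := fun v => by
    have : ∀ i, ∑ j, P v j i • u v j = u v i := by
      intro i
      simp only [u, Finset.smul_sum, smul_smul]
      rw [Finset.sum_comm]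
      refine Finset.sum_congr rfl fun k _ => ?_
      rw [← Finset.sum_smul]
      congr 1
      conv_rhs => rw [← hPP v, Matrix.mul_apply]
      exact Finset.sum_congr rfl fun j _ => mul_comm _ _
    calc ∑ j, star (u v j) * u v j = ∑ i, star (z i) * ∑ j, P v j i • u v j := by
          simp only [hu, Finset.sum_mul, Finset.mul_sum, smul_mul_assoc, mul_smul_comm]
          rw [Finset.sum_comm]
      _ = _ := by simp only [this]
  have e3 : ∀ v, ∑ j, star (p v * z j - u v j) * (p v * z j - u v j)
      = ∑ j, star (z j) * (p v * z j) - ∑ j, star (z j) * u v j := fun v => by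
    have : ∀ j, star (p v * z j - u v j) * (p v * z j - u v j)
        = star (z j) * (p v * z j) - star (z j) * u v j - star (u v j) * z j
          + star (u v j) * u v j := by
      intro j
      have h1 : p v * u v j = u v j := h v j
      have h2 : star (u v j) * p v = star (u v j) := by
        rw [← hps v, ← star_mul, h1]
      rw [star_sub, star_mul, hps, sub_mul, mul_sub, mul_sub]
      rw [mul_assoc, ← mul_assoc (p v) (p v), hpp, mul_assoc _ (p v) (u v j), h1,
        ← mul_assoc _ (p v) (z j), ← mul_assoc _ (p v) (z j), h2]
      abel
    simp only [this, Finset.sum_add_distrib, Finset.sum_sub_distrib, e1, e2]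
    abel
  have e4 : ∑ q : Fin n × Fin d, star (p q.1 * z q.2 - u q.1 q.2) * (p q.1 * z q.2 - u q.1 q.2)
      = 0 := by
    rw [Fintype.sum_prod_type]
    simp only [e3, Finset.sum_sub_distrib]
    rw [Finset.sum_comm, sub_eq_zero]
    have h1 : ∀ j, ∑ v, star (z j) * (p v * z j) = (x : ℂ) • (star (z j) * z j) := fun j => by
      rw [← Finset.mul_sum, ← Finset.sum_mul, hsp, smul_mul_assoc, one_mul, mul_smul_comm]
    simp only [h1]
    rw [Finset.sum_comm]
    refine Finset.sum_congr rfl fun j _ => ?_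
    rw [← Finset.mul_sum, ← mul_smul_comm]
    congr 1
    simp only [u]
    rw [Finset.sum_comm]
    simp only [← Finset.sum_smul]
    have h2 : ∀ i, ∑ v, P v i j = ((x : ℂ) • (1 : Matrix (Fin d) (Fin d) ℂ)) i j := fun i => by
      rw [← hsP, Matrix.sum_apply]
    simp [h2, Matrix.one_apply]
  intro v j
  exact sub_eq_zero.1 (hA (Fin n × Fin d) (fun q => p q.1 * z q.2 - u q.1 q.2) e4 (v, j))

lemma Rl_complex : Rl ℂ := by
  intro ι _ a h i
  have h1 : ∑ i, ‖a i‖ ^ 2 = 0 := by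
    have : ((∑ i, ‖a i‖ ^ 2 : ℝ) : ℂ) = 0 := by
      rw [← h]; push_cast
      exact Finset.sum_congr rfl fun i _ => by rw [← Complex.conj_mul']; rfl
    exact_mod_cast this
  have := (Finset.sum_eq_zero_iff_of_nonneg (fun i _ => sq_nonneg _)).1 h1 i (Finset.mem_univ i)
  simpa using this

lemma ranks {n b d : ℕ} (hd : 0 < d) (hcop : Nat.Coprime b d) (x : ℝ) (hbd : x = (b : ℝ) / d)
    (hq : (b : ℝ) ^ 2 - n * b * d + n * d ^ 2 = n) (hn : 0 < n)
    (P : Fin n → Matrix (Fin d) (Fin d) ℂ) (hPs : ∀ v, (P v)ᴴ = P v) (hP : ∀ v, P v * P v = P v)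
    (hsum : ∑ v, P v = (x : ℂ) • 1) (v : Fin n) : (P v).trace = (((b : ℝ) / n : ℝ) : ℂ) := by
  let k : Fin n → ℝ := fun v => (Module.finrank ℂ (LinearMap.range (Matrix.toLin' (P v))) : ℝ)
  have hk : ∀ v, (P v).trace = (k v : ℂ) := fun v => by
    rw [trace_mat_idem _ (hP v)]; simp [k]
  have hdim := KK_dim P P hP hP k k hk hk
  have h1 : KK P P ≤ Submodule.span ℂ {Matrix.vec (1 : Matrix (Fin d) (Fin d) ℂ)} := by
    intro w hw
    obtain ⟨Z, rfl⟩ : ∃ Z : Matrix (Fin d) (Fin d) ℂ, w = Matrix.vec Z :=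
      ⟨Matrix.of fun i j => w (j, i), by ext ⟨i, j⟩; rfl⟩
    rw [mem_KK] at hw
    let i0 : Fin d := ⟨0, hd⟩
    have hint := intertwine (x := x) (Rl_complex.matrix (Fin d)) P
      (fun v => hPs v) hP hsum P hPs hP hsum
      (fun j => Matrix.of fun a c => if c = i0 then Z a j else 0) (by
        intro v j
        have h2 : (∑ i, P v i j • (Matrix.of fun a c => if c = i0 then Z a i else 0 :
            Matrix (Fin d) (Fin d) ℂ)) = Matrix.of fun a c => if c = i0 then (Z * P v) a j else 0 := by
          ext a c
          simp only [Matrix.sum_apply, Matrix.smul_apply, Matrix.of_apply, Matrix.mul_apply]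
          split_ifs
          · exact Finset.sum_congr rfl fun i _ => mul_comm _ _
          · simp
        rw [h2]
        ext a c
        have h3 : P v * (Z * P v) = Z * P v := by
          have := hw v
          rw [sub_mul, one_mul, sub_mul, sub_eq_zero, mul_assoc] at this
          exact this.symm
        have h4 := congrFun (congrFun h3 a) j
        rw [Matrix.mul_apply] at h4
        simp only [Matrix.mul_apply (M := P v) (N := Matrix.of _), Matrix.of_apply]
        split_ifs
        · exact h4
        · simp)
    obtain ⟨c, hc⟩ := scalar_of_comm hd hcop x hbd P hP hsum Z (by
      intro v
      ext a j
      have := congrFun (congrFun (hint v j) a) i0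
      simp only [Matrix.mul_apply, Matrix.sum_apply, Matrix.of_apply, Matrix.smul_apply, if_true,
        smul_eq_mul] at this
      rw [Matrix.mul_apply, Matrix.mul_apply, this]
      exact Finset.sum_congr rfl fun i _ => mul_comm _ _)
    rw [hc]
    exact Submodule.mem_span_singleton.2 ⟨c, by ext; simp [Matrix.vec]⟩
  have h2 : (Module.finrank ℂ (KK P P) : ℝ) ≤ 1 := by
    exact_mod_cast (Submodule.finrank_mono h1).trans ((finrank_span_le_card _).trans (by simp))
  have hd' : (d : ℝ) ≠ 0 := by positivity
  have hksum : ∑ v, k v = b := by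
    have := congrArg Matrix.trace hsum
    rw [Matrix.trace_sum, Matrix.trace_smul, Matrix.trace_one] at this
    simp only [hk] at this
    have h3 : ((∑ v, k v : ℝ) : ℂ) = ((x * d : ℝ) : ℂ) := by
      push_cast; rw [this]; simp
    have h4 : ∑ v, k v = x * d := by exact_mod_cast h3
    rw [h4, hbd]; field_simp
  have h3 : ∑ v, k v * (d - k v) = b * d - ∑ v, k v ^ 2 := by
    rw [← hksum, Finset.sum_mul, ← Finset.sum_sub_distrib]
    exact Finset.sum_congr rfl fun v _ => by ring
  have h4 : ∑ v, ((n : ℝ) * k v - b) ^ 2 = n * (n * ∑ v, k v ^ 2 - b ^ 2) := by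
    have : ∀ v, ((n : ℝ) * k v - b) ^ 2 = n ^ 2 * k v ^ 2 - 2 * n * b * k v + b ^ 2 := fun v => by ring
    simp only [this, Finset.sum_add_distrib, Finset.sum_sub_distrib, ← Finset.mul_sum, hksum]
    simp; ring
  have hn' : (0 : ℝ) < n := by positivity
  have h5 : ∑ v, ((n : ℝ) * k v - b) ^ 2 = 0 := by
    apply le_antisymm
    · rw [h4]
      apply mul_nonpos_of_nonneg_of_nonpos hn'.le
      have : ∑ v, k v ^ 2 ≤ 1 + b * d - d * d := by linarith
      nlinarith
    · exact Finset.sum_nonneg fun v _ => sq_nonneg _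
  have h6 := (Finset.sum_eq_zero_iff_of_nonneg (fun i _ => sq_nonneg _)).1 h5 v (Finset.mem_univ v)
  have h7 : (n : ℝ) * k v - b = 0 := by simpa using h6
  rw [hk]
  congr 1
  field_simp; linarith

lemma exists_intertwiner {A : Type} [Ring A] [StarRing A] [Algebra ℂ A] [StarModule ℂ A]
    (hA : Rl A) {n b d : ℕ} (hd : 0 < d) (hcop : Nat.Coprime b d) (x : ℝ) (hbd : x = (b : ℝ) / d)
    (hq : (b : ℝ) ^ 2 - n * b * d + n * d ^ 2 = n) (hn : 0 < n)
    (P : Fin n → Matrix (Fin d) (Fin d) ℂ) (hPs : ∀ v, (P v)ᴴ = P v) (hP : ∀ v, P v * P v = P v)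
    (hsum : ∑ v, P v = (x : ℂ) • 1)
    (p : Fin n → A) (hps : ∀ v, star (p v) = p v) (hpp : ∀ v, p v * p v = p v)
    (hsp : ∑ v, p v = (x : ℂ) • 1)
    (M : Submodule ℂ A) [FiniteDimensional ℂ M] (hM : M ≠ ⊥) (hpM : ∀ v, ∀ a ∈ M, p v * a ∈ M) :
    ∃ z : Fin d → A, z ≠ 0 ∧ (∀ j, z j ∈ M) ∧ ∀ v j, p v * z j = ∑ i, P v i j • z i := by
  let D := Module.finrank ℂ M
  let bM : Module.Basis (Fin D) ℂ M := Module.finBasis ℂ M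
  let L : Fin n → (M →ₗ[ℂ] M) := fun v => (LinearMap.mulLeft ℂ (p v)).restrict (hpM v)
  let T : Fin n → Matrix (Fin D) (Fin D) ℂ := fun v => LinearMap.toMatrix bM bM (L v)
  let lin : (Fin D → ℂ) →ₗ[ℂ] A := M.subtype ∘ₗ bM.equivFun.symm.toLinearMap
  have hlin_inj : Function.Injective lin := by
    intro a c h
    exact bM.equivFun.symm.injective (Subtype.ext h)
  have hlinM : ∀ c, lin c ∈ M := fun c => (bM.equivFun.symm c).2
  have hlin : ∀ v c, p v * lin c = lin (T v *ᵥ c) := by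
    intro v c
    have h1 : bM.equivFun.symm (T v *ᵥ c) = L v (bM.equivFun.symm c) := by
      rw [LinearEquiv.symm_apply_eq]
      have := LinearMap.toMatrix_mulVec_repr bM bM (L v) (bM.equivFun.symm c)
      simp only [Module.Basis.equivFun_apply]
      rw [← this]
      congr 1
      exact (bM.equivFun.apply_symm_apply c).symm
    have h2 := congrArg (Subtype.val) h1
    exact h2.symm
  have hLv : ∀ v m, ((L v m : M) : A) = p v * (m : A) := fun _ _ => rfl
  have hLL : ∀ v, L v * L v = L v := fun v => by
    ext m
    rw [Module.End.mul_apply, hLv, hLv, ← mul_assoc, hpp]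
  have hTT : ∀ v, T v * T v = T v := fun v => by
    simp only [T]
    rw [← LinearMap.toMatrix_mul, hLL]
  have hTs : ∑ v, T v = (x : ℂ) • 1 := by
    simp only [T]
    rw [← map_sum, ← LinearMap.toMatrix_one bM, ← map_smul]
    congr 1
    ext m
    have := congrArg (· * (m : A)) hsp
    simpa [LinearMap.sum_apply, hLv, Finset.sum_mul] using this
  let k : Fin n → ℝ := fun v => (Module.finrank ℂ (LinearMap.range (Matrix.toLin' (T v))) : ℝ)
  have hk : ∀ v, (T v).trace = (k v : ℂ) := fun v => by
    rw [trace_mat_idem _ (hTT v)]; simp [k]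
  have hd' : (0 : ℝ) < d := by positivity
  have hn' : (0 : ℝ) < n := by positivity
  have hksum : ∑ v, k v = b / d * D := by
    have := congrArg Matrix.trace hTs
    rw [Matrix.trace_sum, Matrix.trace_smul, Matrix.trace_one] at this
    simp only [hk] at this
    have h3 : ((∑ v, k v : ℝ) : ℂ) = ((x * D : ℝ) : ℂ) := by
      push_cast; rw [this]; simp
    have h4 : ∑ v, k v = x * D := by exact_mod_cast h3
    rw [h4, hbd]
  have hdim := KK_dim T P hTT hP k (fun _ => (b : ℝ) / n) hk (ranks hd hcop x hbd hq hn P hPs hP hsum)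
  have hD : 0 < D := by
    rw [Nat.pos_iff_ne_zero]; intro h0; exact hM (Submodule.finrank_eq_zero.1 h0)
  have hD' : (0 : ℝ) < D := by positivity
  have hne : KK T P ≠ ⊥ := by
    intro h0
    rw [h0, finrank_bot, ← Finset.mul_sum, Finset.sum_sub_distrib, hksum] at hdim
    simp only [Finset.sum_const, Finset.card_univ, Fintype.card_fin, nsmul_eq_mul, Nat.cast_zero,
      zero_add] at hdim
    have h1 : (b : ℝ) / n * (n * D - b / d * D) = D * (b * n * d - b ^ 2) / (n * d) := by
      field_simp
    rw [h1, le_div_iff₀ (by positivity)] at hdim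
    have : (0 : ℝ) < D * n := by positivity
    have h2 : (D : ℝ) * ((b : ℝ) ^ 2 - n * b * d + n * d ^ 2) = D * n := by rw [hq]
    nlinarith
  obtain ⟨w, hw, hw0⟩ := Submodule.exists_mem_ne_zero_of_ne_bot hne
  obtain ⟨Z, rfl⟩ : ∃ Z : Matrix (Fin D) (Fin d) ℂ, w = Matrix.vec Z :=
    ⟨Matrix.of fun i j => w (j, i), by ext ⟨i, j⟩; rfl⟩
  rw [mem_KK] at hw
  let z : Fin d → A := fun j => lin (Z.col j)
  have hzP : ∀ (Q : Matrix (Fin d) (Fin d) ℂ) j, ∑ i, Q i j • z i = lin ((Z * Q).col j) := by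
    intro Q j
    simp only [z]
    simp only [← map_smul]
    rw [← map_sum]
    congr 1
    ext a
    simp [Matrix.mul_apply, Finset.sum_apply, mul_comm]
  refine ⟨z, ?_, fun j => hlinM _, ?_⟩
  · intro h0
    apply hw0
    rw [Matrix.vec_eq_zero_iff]
    ext a j
    have h1 : lin (Z.col j) = lin 0 := by rw [map_zero]; exact congrFun h0 j
    exact congrFun (hlin_inj h1) a
  · apply intertwine hA p hps hpp hsp P hPs hP hsum
    intro v j
    rw [hzP, hlin]
    congr 1
    have h3 : T v * (Z * P v) = Z * P v := by
      have := hw v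
      rw [Matrix.sub_mul, Matrix.one_mul, Matrix.sub_mul, sub_eq_zero, Matrix.mul_assoc] at this
      exact this.symm
    conv_rhs => rw [← h3]
    rfl

lemma main_abs {A : Type} [Ring A] [StarRing A] [Algebra ℂ A] [StarModule ℂ A]
    (hA : Rl A) {n b d : ℕ} (hd : 0 < d) (hcop : Nat.Coprime b d) (x : ℝ) (hbd : x = (b : ℝ) / d)
    (hq : (b : ℝ) ^ 2 - n * b * d + n * d ^ 2 = n) (hn : 0 < n)
    (P : Fin n → Matrix (Fin d) (Fin d) ℂ) (hPs : ∀ v, (P v)ᴴ = P v) (hP : ∀ v, P v * P v = P v)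
    (hsum : ∑ v, P v = (x : ℂ) • 1)
    (p : Fin n → A) (hps : ∀ v, star (p v) = p v) (hpp : ∀ v, p v * p v = p v)
    (hsp : ∑ v, p v = (x : ℂ) • 1)
    (hgen : ∀ U : Submodule ℂ A, 1 ∈ U → (∀ v, ∀ a ∈ U, p v * a ∈ U) → U = ⊤)
    (hFD : FD n x) :
    ∃ f : Fin d → A, ∑ j, star (f j) * f j = 1 ∧
      ∀ v, ∑ j, ∑ k, P v j k • (star (f j) * f k) = p v := by
  obtain ⟨W, hWf, h1W, -, hpW⟩ := hFD A hA 1 p (star_one A) (mul_one 1)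
    (fun v => ⟨hps v, hpp v, one_mul _, mul_one _⟩) hsp
  have hWtop := hgen W h1W hpW
  have hfin : FiniteDimensional ℂ A := by
    have : FiniteDimensional ℂ (⊤ : Submodule ℂ A) := hWtop ▸ hWf
    exact Module.finite_def.2 (Submodule.fg_top _ |>.1 (Module.finite_def.1 this)) 
  rcases subsingleton_or_nontrivial A with hss | hnt
  · exact ⟨fun _ => 0, Subsingleton.elim _ _, fun v => Subsingleton.elim _ _⟩
  have ex := fun (M : Submodule ℂ A) (hM : M ≠ ⊥) hpM =>
    exists_intertwiner hA hd hcop x hbd hq hn P hPs hP hsum p hps hpp hsp M hM hpM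
  obtain ⟨z, hz0, -, hz⟩ := ex ⊤ top_ne_bot (fun _ _ _ => trivial)
  have hPc : ∀ v i j, star (P v i j) = P v j i := fun v i j => by
    conv_rhs => rw [← hPs v]
    rfl
  let y : A := ∑ j, z j * star (z j)
  have hys : star y = y := by simp [y, star_sum]
  have hpy0 : ∀ v, ∑ j, ∑ k, P v j k • (z j * star (z k)) = p v * y := by
    intro v
    simp only [y, Finset.mul_sum, ← mul_assoc, hz, Finset.sum_mul, smul_mul_assoc]
    rw [Finset.sum_comm]
  have hyp0 : ∀ v, ∑ j, ∑ k, P v j k • (z j * star (z k)) = y * p v := by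
    intro v
    have : ∀ j, star (z j) * p v = ∑ k, P v j k • star (z k) := fun j => by
      rw [← hps v, ← star_mul, hz, star_sum]
      exact Finset.sum_congr rfl fun k _ => by rw [star_smul, hPc]
    simp only [y, Finset.sum_mul, mul_assoc, this, Finset.mul_sum, mul_smul_comm]
  have hcomm : ∀ v, p v * y = y * p v := fun v => by rw [← hpy0, hyp0]
  -- every element acts on intertwiners through a scalar matrix
  let Uact : Submodule ℂ A :=
    { carrier := {a | ∃ X : Matrix (Fin d) (Fin d) ℂ, ∀ z' : Fin d → A,
        (∀ v j, p v * z' j = ∑ i, P v i j • z' i) → ∀ j, a * z' j = ∑ i, X i j • z' i}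
      add_mem' := by
        rintro a c ⟨X, hX⟩ ⟨Y, hY⟩
        refine ⟨X + Y, fun z' hz' j => ?_⟩
        simp [add_mul, hX z' hz', hY z' hz', add_smul, Finset.sum_add_distrib]
      zero_mem' := ⟨0, fun z' hz' j => by simp⟩
      smul_mem' := by
        rintro c a ⟨X, hX⟩
        refine ⟨c • X, fun z' hz' j => ?_⟩
        simp [hX z' hz', Finset.smul_sum, smul_smul] }
  have hUtop : Uact = ⊤ := by
    apply hgen
    · refine ⟨1, fun z' hz' j => ?_⟩
      simp [Matrix.one_apply]
    · rintro v a ⟨X, hX⟩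
      refine ⟨P v * X, fun z' hz' j => ?_⟩
      rw [mul_assoc, hX z' hz']
      simp only [Finset.mul_sum, mul_smul_comm, hz' v, Finset.smul_sum, smul_smul, Matrix.mul_apply,
        Finset.sum_smul]
      rw [Finset.sum_comm]
      exact Finset.sum_congr rfl fun i _ => Finset.sum_congr rfl fun k _ => by rw [mul_comm]
  obtain ⟨X, hX⟩ : y ∈ Uact := by rw [hUtop]; trivial
  -- z is injective on ℂ^d
  have hker : ∀ ξ : Fin d → ℂ, ∑ i, ξ i • z i = 0 → ξ = 0 := by
    let lz : (Fin d → ℂ) →ₗ[ℂ] A := Fintype.linearCombination ℂ z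
    have hlz : ∀ ξ, lz ξ = ∑ i, ξ i • z i := fun ξ => Fintype.linearCombination_apply _ _ _
    have hinv : ∀ v, ∀ u ∈ LinearMap.ker lz, P v *ᵥ u ∈ LinearMap.ker lz := by
      intro v u hu
      rw [LinearMap.mem_ker, hlz] at hu ⊢
      have := congrArg (p v * ·) hu
      simp only [Finset.mul_sum, mul_smul_comm, hz, Finset.smul_sum, mul_zero, smul_smul] at this
      rw [Finset.sum_comm] at this
      rw [← this]
      refine Finset.sum_congr rfl fun i _ => ?_
      rw [← Finset.sum_smul]
      congr 1
      simp only [Matrix.mulVec, dotProduct]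
      exact Finset.sum_congr rfl fun j _ => mul_comm _ _
    rcases irred hd hcop x hbd P hP hsum (LinearMap.ker lz) hinv with h | h
    · intro ξ hξ
      have : ξ ∈ LinearMap.ker lz := by rw [LinearMap.mem_ker, hlz]; exact hξ
      rw [h] at this
      exact this
    · exfalso
      apply hz0
      ext j
      have : Pi.single j 1 ∈ LinearMap.ker lz := by rw [h]; trivial
      rw [LinearMap.mem_ker, hlz] at this
      simpa [Pi.single_apply] using this
  have hXz := hX z hz
  obtain ⟨c, hc⟩ := scalar_of_comm hd hcop x hbd P hP hsum X (by
    intro v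
    ext i0 j
    have h1 : y * (p v * z j) = ∑ i, (X * P v) i j • z i := by
      rw [hz]
      simp only [Finset.mul_sum, mul_smul_comm, hXz, Finset.smul_sum, smul_smul, Matrix.mul_apply,
        Finset.sum_smul]
      rw [Finset.sum_comm]
      exact Finset.sum_congr rfl fun i _ => Finset.sum_congr rfl fun k _ => by rw [mul_comm]
    have h2 : p v * (y * z j) = ∑ i, (P v * X) i j • z i := by
      rw [hXz]
      simp only [Finset.mul_sum, mul_smul_comm, hz v, Finset.smul_sum, smul_smul, Matrix.mul_apply,
        Finset.sum_smul]
      rw [Finset.sum_comm]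
      exact Finset.sum_congr rfl fun i _ => Finset.sum_congr rfl fun k _ => by rw [mul_comm]
    have h3 : ∑ i, ((X * P v) i j - (P v * X) i j) • z i = 0 := by
      simp only [sub_smul, Finset.sum_sub_distrib, ← h1, ← h2]
      rw [← mul_assoc, ← mul_assoc, hcomm, sub_self]
    exact sub_eq_zero.1 (congrFun (hker _ h3) i0))
  have hyz : ∀ z' : Fin d → A, (∀ v j, p v * z' j = ∑ i, P v i j • z' i) →
      ∀ j, y * z' j = c • z' j := by
    intro z' hz' j
    rw [hX z' hz', hc]
    simp [Matrix.one_apply]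
  -- y is scalar
  have hyc : y = (star c) • 1 := by
    by_contra hne
    let m : A := y - (star c) • 1
    have hm0 : m ≠ 0 := sub_ne_zero.2 hne
    have hpm : ∀ v, p v * m = m * p v := fun v => by
      simp [m, mul_sub, sub_mul, hcomm]
    obtain ⟨z', hz'0, hz'M, hz'⟩ := ex (LinearMap.range (LinearMap.mulLeft ℂ m))
      (by
        intro h
        have : m ∈ LinearMap.range (LinearMap.mulLeft ℂ m) := ⟨1, by simp⟩
        rw [h] at this
        exact hm0 this)
      (by
        rintro v _ ⟨a, rfl⟩
        exact ⟨p v * a, by simp [← mul_assoc, hpm]⟩)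
    apply hz'0
    ext j
    obtain ⟨a, ha⟩ := hz'M j
    rw [LinearMap.mulLeft_apply] at ha
    have h0 : star (z' j) * z' j = 0 := by
      conv_lhs => rw [← ha, star_mul, mul_assoc, ha]
      have : star m * z' j = 0 := by
        simp only [m, star_sub, star_smul, star_star, star_one, sub_mul, smul_mul_assoc, one_mul, hys]
        rw [hyz z' hz', sub_self]
      rw [this, mul_zero]
    exact hA Unit (fun _ => z' j) (by simpa using h0) ()
  have hcr : star c = c := by
    have h1 : star y = c • 1 := by rw [hyc, star_smul, star_star, star_one]
    rw [hys, hyc] at h1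
    have : (star c - c) • (1 : A) = 0 := by rw [sub_smul, h1, sub_self]
    rcases smul_eq_zero.1 this with h | h
    · exact sub_eq_zero.1 h
    · exact absurd h one_ne_zero
  obtain ⟨t, rfl⟩ : ∃ t : ℝ, c = (t : ℂ) := ⟨c.re, (Complex.conj_eq_iff_real.1 hcr).elim fun r hr => by rw [hr]; simp⟩
  rw [hcr] at hyc
  have ht : 0 < t := by
    by_contra hle
    push Not at hle
    apply hz0
    have h0 : ∑ q : Option (Fin d), star ((fun q : Option (Fin d) => q.elim (((Real.sqrt (-t) : ℝ) : ℂ) • (1 : A)) (fun j => star (z j))) q)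
        * ((fun q : Option (Fin d) => q.elim (((Real.sqrt (-t) : ℝ) : ℂ) • (1 : A)) (fun j => star (z j))) q) = 0 := by
      rw [Fintype.sum_option]
      simp only [Option.elim, star_star]
      change _ + y = 0
      rw [hyc, star_smul, star_one, smul_mul_assoc, one_mul, smul_smul, ← add_smul]
      have : star ((Real.sqrt (-t) : ℝ) : ℂ) * ((Real.sqrt (-t) : ℝ) : ℂ) + (t : ℂ) = 0 := by
        rw [Complex.star_def, Complex.conj_ofReal]
        rw [← Complex.ofReal_mul, Real.mul_self_sqrt (by linarith)]
        simp
      rw [this, zero_smul]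
    ext j
    have := hA (Option (Fin d)) _ h0 (some j)
    simpa using this
  let s : ℂ := ((Real.sqrt t)⁻¹ : ℝ)
  have hss : star s * s * t = 1 := by
    simp only [s]
    rw [Complex.star_def, Complex.conj_ofReal]
    norm_cast
    have : Real.sqrt t ≠ 0 := (Real.sqrt_pos.2 ht).ne'
    field_simp
    rw [Real.sq_sqrt ht.le]
  have hff : ∀ j k, star (s • star (z j)) * (s • star (z k)) = (star s * s) • (z j * star (z k)) := by
    intro j k
    rw [star_smul, star_star, smul_mul_assoc, mul_smul_comm, smul_smul]
  refine ⟨fun j => s • star (z j), ?_, ?_⟩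
  · simp only [hff, ← Finset.smul_sum]
    change _ • y = 1
    rw [hyc, smul_smul, hss, one_smul]
  · intro v
    simp only [hff]
    have : ∀ j k, P v j k • (star s * s) • (z j * star (z k)) = (star s * s) • P v j k • (z j * star (z k)) :=
      fun j k => smul_comm _ _ _
    simp only [this, ← Finset.smul_sum, hpy0]
    rw [hyc, mul_smul_comm, mul_one, smul_smul, hss, one_smul]

lemma num_aux (n : ℕ) : ∀ l, (∀ j < l, lambdaSeq n j < n - 1) →
    FD n (lambdaSeq n l) ∧ ∃ b d : ℤ, 0 < d ∧ IsCoprime b d ∧ lambdaSeq n l = (b : ℝ) / d ∧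
      b ^ 2 - n * b * d + n * d ^ 2 = n := by
  intro l
  induction l with
  | zero =>
    intro _
    refine ⟨FD_zero n, 0, 1, by norm_num, isCoprime_one_right, by simp [lambdaSeq], by ring⟩
  | succ l ih =>
    intro h
    obtain ⟨hF, b, d, hd, hc, hx, hq⟩ := ih fun j hj => h j (by omega)
    have hl := h l (by omega)
    have ht : (0 : ℝ) < n - 1 - lambdaSeq n l := by linarith
    have hd' : (0 : ℝ) < d := by exact_mod_cast hd
    have hpos : (0 : ℝ) < (n - 1) * d - b := by
      rw [hx] at ht
      have := mul_pos ht hd'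
      have h2 : ((n : ℝ) - 1 - b / d) * d = (n - 1) * d - b := by field_simp
      linarith
    constructor
    · have h1 : lambdaSeq n (l + 1) = 1 + 1 / (n - 1 - lambdaSeq n l) := rfl
      have h2 : 0 < 1 / ((n : ℝ) - 1 - lambdaSeq n l) := by positivity
      refine FD_step n _ (lambdaSeq n l) (by rw [h1]; positivity) (by rw [h1]; linarith) ?_ hF
      rw [h1]
      have h3 : (1 + 1 / ((n : ℝ) - 1 - lambdaSeq n l)) / (1 + 1 / ((n : ℝ) - 1 - lambdaSeq n l) - 1)
          = (n - 1 - lambdaSeq n l) + 1 := by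
        have h4 := ht.ne'
        rw [add_sub_cancel_left]
        field_simp
      linarith
    · refine ⟨n * d - b, (n - 1) * d - b, by exact_mod_cast hpos, ?_, ?_, by nlinarith⟩
      · obtain ⟨u, v, huv⟩ := hc
        refine ⟨u * (n - 1) + v, -(u * n) - v, ?_⟩
        linear_combination huv
      · change 1 + 1 / ((n : ℝ) - 1 - lambdaSeq n l) = _
        rw [hx]
        push_cast
        rw [hx] at ht
        have h2 : (n : ℝ) - 1 - b / d = ((n - 1) * d - b) / d := by field_simp
        rw [h2]
        field_simp
        ring

lemma num_main {n b d : ℕ} (hn : 3 ≤ n) (x : ℝ) (hx : x ∈ Lambda n)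
    (hd : 0 < d) (hcop : Nat.Coprime b d) (hbd : x = (b : ℝ) / d) :
    FD n x ∧ (b : ℝ) ^ 2 - n * b * d + n * d ^ 2 = n := by
  have key : FD n x ∧ ∃ b d : ℤ, 0 < d ∧ IsCoprime b d ∧ x = (b : ℝ) / d ∧
      b ^ 2 - n * b * d + n * d ^ 2 = n := by
    by_cases h3 : n = 3
    · subst h3
      simp only [Lambda, if_true, Set.mem_singleton_iff] at hx
      have := num_aux 3 1 (by intro j hj; interval_cases j; norm_num [lambdaSeq])
      have h1 : lambdaSeq 3 1 = x := by rw [hx]; norm_num [lambdaSeq]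
      rwa [h1] at this
    · simp only [Lambda, if_neg h3, Set.mem_range] at hx
      obtain ⟨l, rfl⟩ := hx
      have hn4 : (4 : ℝ) ≤ n := by
        have : 4 ≤ n := by omega
        exact_mod_cast this
      have hb : ∀ j, lambdaSeq n j ≤ 2 := by
        intro j
        induction j with
        | zero => simp [lambdaSeq]
        | succ j ih =>
          change 1 + 1 / ((n : ℝ) - 1 - lambdaSeq n j) ≤ 2
          have : 1 / ((n : ℝ) - 1 - lambdaSeq n j) ≤ 1 := by
            rw [div_le_one (by linarith)]; linarith
          linarith
      exact num_aux n l fun j _ => by have := hb j; linarith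
  obtain ⟨hF, b', d', hd', hc', hx', hq'⟩ := key
  refine ⟨hF, ?_⟩
  have hcop' : IsCoprime (b : ℤ) d := Nat.isCoprime_iff_coprime.2 hcop
  have hdR : (0 : ℝ) < d := by positivity
  have hdR' : (0 : ℝ) < d' := by exact_mod_cast hd'
  have hcross : (b : ℤ) * d' = b' * d := by
    have : (b : ℝ) * d' = b' * d := by
      rw [hbd, div_eq_div_iff hdR.ne' hdR'.ne'] at hx'; exact hx'
    exact_mod_cast this
  have h1 : (d : ℤ) ∣ d' := hcop'.symm.dvd_of_dvd_mul_left (hcross ▸ Dvd.intro_left _ rfl)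
  have h2 : d' ∣ (d : ℤ) := hc'.symm.dvd_of_dvd_mul_left (hcross ▸ Dvd.intro_left _ rfl)
  have h3 : d' = (d : ℤ) := Int.dvd_antisymm hd'.le (by positivity) h2 h1
  subst h3
  have h4 : (b : ℤ) = b' := mul_right_cancel₀ (by positivity) hcross
  subst h4
  exact_mod_cast hq'

/-- squared seminorm -/
def nsq {r : ℕ} (ρ X : Matrix (Fin r) (Fin r) ℂ) : ℝ := ((Xᴴ * X * ρ).trace).re

lemma tr_nonneg {r : ℕ} {ρ M : Matrix (Fin r) (Fin r) ℂ} (hρ : ρ.PosSemidef) (hM : M.PosSemidef) :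
    0 ≤ ((M * ρ).trace).re := by
  obtain ⟨B, rfl⟩ : ∃ B : Matrix (Fin r) (Fin r) ℂ, ρ = Bᴴ * B := by
    open scoped MatrixOrder in
    exact (CStarAlgebra.nonneg_iff_eq_star_mul_self (a := ρ)).1 hρ.nonneg
  have h1 : (M * (Bᴴ * B)).trace = (B * M * Bᴴ).trace := by
    rw [← mul_assoc, Matrix.trace_mul_comm, mul_assoc]
  rw [h1]
  exact (Complex.nonneg_iff.1 (hM.mul_mul_conjTranspose_same B).trace_nonneg).1

section nsqs
variable {r : ℕ} {ρ : Matrix (Fin r) (Fin r) ℂ}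

lemma tr_mono (hρ : ρ.PosSemidef) {M N : Matrix (Fin r) (Fin r) ℂ} (h : (N - M).PosSemidef) :
    ((M * ρ).trace).re ≤ ((N * ρ).trace).re := by
  have := tr_nonneg hρ h
  rw [sub_mul, Matrix.trace_sub, Complex.sub_re] at this
  linarith

lemma nsq_nonneg (hρ : ρ.PosSemidef) (X : Matrix (Fin r) (Fin r) ℂ) : 0 ≤ nsq ρ X :=
  tr_nonneg hρ (Matrix.posSemidef_conjTranspose_mul_self X)

lemma nsq_smul (c : ℂ) (X : Matrix (Fin r) (Fin r) ℂ) : nsq ρ (c • X) = ‖c‖ ^ 2 * nsq ρ X := by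
  unfold nsq
  rw [Matrix.conjTranspose_smul, Matrix.smul_mul, Matrix.mul_smul, smul_smul, Matrix.smul_mul,
    Matrix.trace_smul, Complex.star_def, Complex.conj_mul', smul_eq_mul, ← Complex.ofReal_pow,
    Complex.re_ofReal_mul]

lemma nsq_zero : nsq ρ 0 = 0 := by simp [nsq]

lemma nsq_neg (X : Matrix (Fin r) (Fin r) ℂ) : nsq ρ (-X) = nsq ρ X := by simp [nsq]

lemma par (X Y : Matrix (Fin r) (Fin r) ℂ) :
    (2 : ℂ) • (Xᴴ * X) + (2 : ℂ) • (Yᴴ * Y) - (X + Y)ᴴ * (X + Y) = (X - Y)ᴴ * (X - Y) := by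
  simp only [Matrix.conjTranspose_add, Matrix.conjTranspose_sub, two_smul]
  noncomm_ring

lemma nsq_add_le (hρ : ρ.PosSemidef) (X Y : Matrix (Fin r) (Fin r) ℂ) :
    nsq ρ (X + Y) ≤ 2 * nsq ρ X + 2 * nsq ρ Y := by
  have := tr_mono hρ (M := (X + Y)ᴴ * (X + Y)) (N := (2 : ℂ) • (Xᴴ * X) + (2 : ℂ) • (Yᴴ * Y))
    (by rw [par]; exact Matrix.posSemidef_conjTranspose_mul_self _)
  simpa [nsq, add_mul, Matrix.trace_add, Matrix.trace_smul] using this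

/-- boundedness by `sqrt c` -/
def Bd (c : ℝ) (Y : Matrix (Fin r) (Fin r) ℂ) : Prop := ((c : ℂ) • 1 - Yᴴ * Y).PosSemidef

lemma Bd.conj {c : ℝ} {Y : Matrix (Fin r) (Fin r) ℂ} (h : Bd c Y) (X : Matrix (Fin r) (Fin r) ℂ) :
    ((c : ℂ) • (Xᴴ * X) - (Y * X)ᴴ * (Y * X)).PosSemidef := by
  have := Matrix.PosSemidef.conjTranspose_mul_mul_same h X
  convert this using 1
  simp [Matrix.mul_sub, Matrix.sub_mul, mul_assoc]

lemma nsq_mul_le (hρ : ρ.PosSemidef) {c : ℝ} {Y : Matrix (Fin r) (Fin r) ℂ} (h : Bd c Y)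
    (X : Matrix (Fin r) (Fin r) ℂ) : nsq ρ (Y * X) ≤ c * nsq ρ X := by
  have := tr_mono hρ (h.conj X)
  simpa [nsq, Matrix.trace_smul] using this

lemma psd_smul {c : ℝ} (hc : 0 ≤ c) {M : Matrix (Fin r) (Fin r) ℂ} (h : M.PosSemidef) :
    ((c : ℂ) • M).PosSemidef := h.smul (by exact_mod_cast hc)

lemma Bd.mul {c c' : ℝ} (hc : 0 ≤ c) {Y X : Matrix (Fin r) (Fin r) ℂ} (h : Bd c Y) (h' : Bd c' X) :
    Bd (c * c') (Y * X) := by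
  have := (h.conj X).add (psd_smul hc h')
  unfold Bd
  convert this using 1
  rw [smul_sub, smul_smul, Complex.ofReal_mul]
  abel

lemma Bd.add {c c' : ℝ} {Y X : Matrix (Fin r) (Fin r) ℂ} (h : Bd c Y) (h' : Bd c' X) :
    Bd (2 * c + 2 * c') (Y + X) := by
  have := ((psd_smul zero_le_two h).add (psd_smul zero_le_two h')).add
    (Matrix.posSemidef_conjTranspose_mul_self (Y - X))
  rw [← par] at this
  unfold Bd
  convert this using 1
  simp only [Complex.ofReal_add, Complex.ofReal_mul, Complex.ofReal_ofNat, add_smul, mul_smul, smul_sub]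
  abel

lemma Bd.smul {c : ℝ} {Y : Matrix (Fin r) (Fin r) ℂ} (h : Bd c Y) (k : ℂ) :
    Bd (‖k‖ ^ 2 * c) (k • Y) := by
  have := psd_smul (sq_nonneg ‖k‖) h
  unfold Bd
  convert this using 1
  rw [Matrix.conjTranspose_smul, Matrix.smul_mul, Matrix.mul_smul, smul_smul, Complex.star_def,
    Complex.conj_mul', smul_sub, smul_smul]
  push_cast
  rfl

lemma Bd_one : Bd 1 (1 : Matrix (Fin r) (Fin r) ℂ) := by
  unfold Bd; simpa using Matrix.PosSemidef.zero

lemma Bd_contr {E : Matrix (Fin r) (Fin r) ℂ} (h : E.PosSemidef) (h' : (1 - E).PosSemidef) :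
    Bd 1 E := by
  have h1 := h'.conjTranspose_mul_mul_same E
  have h2 := h.conjTranspose_mul_mul_same (1 - E)
  have := (h1.add h2).add h'
  unfold Bd
  convert this using 1
  rw [Matrix.conjTranspose_sub, h.isHermitian.eq, Matrix.conjTranspose_one]
  simp only [Complex.ofReal_one, one_smul]
  noncomm_ring

lemma tr_sq_le (hρ : ρ.PosSemidef) (h1 : ρ.trace = 1) (H : Matrix (Fin r) (Fin r) ℂ) :
    ‖(H * ρ).trace‖ ^ 2 ≤ nsq ρ H := by
  have h0 := nsq_nonneg hρ (H - (H * ρ).trace • 1)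
  have ht : (Hᴴ * ρ).trace = star ((H * ρ).trace) := by
    rw [← Matrix.trace_conjTranspose, Matrix.conjTranspose_mul, hρ.isHermitian.eq, Matrix.trace_mul_comm]
  set t := (H * ρ).trace with htd
  have : ((H - t • 1)ᴴ * (H - t • 1) * ρ).trace = (Hᴴ * H * ρ).trace - star t * t := by
    simp only [Matrix.conjTranspose_sub, Matrix.conjTranspose_smul, Matrix.conjTranspose_one,
      Matrix.sub_mul, Matrix.mul_sub, Matrix.smul_mul, Matrix.mul_smul, Matrix.one_mul, Matrix.mul_one,
      Matrix.trace_sub, Matrix.trace_smul, smul_eq_mul, h1, ht, ← htd]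
    ring
  unfold nsq at h0 ⊢
  rw [this, Complex.star_def, Complex.conj_mul', ← Complex.ofReal_pow, Complex.sub_re, Complex.ofReal_re] at h0
  linarith

end nsqs

section quot
variable {S : Type} [Ring S] [StarRing S] [Algebra ℂ S] [StarModule ℂ S]

lemma abs_quot (I : Ideal S) (hI : I.IsTwoSided) (hIs : ∀ a ∈ I, star a ∈ I)
    (hIr : ∀ (ι : Type) [Fintype ι] (a : ι → S), ∑ i, star (a i) * a i ∈ I → ∀ i, a i ∈ I)
    {n b d : ℕ} (hd : 0 < d) (hcop : Nat.Coprime b d) (x : ℝ) (hbd : x = (b : ℝ) / d)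
    (hq : (b : ℝ) ^ 2 - n * b * d + n * d ^ 2 = n) (hn : 0 < n)
    (P : Fin n → Matrix (Fin d) (Fin d) ℂ) (hPs : ∀ v, (P v)ᴴ = P v) (hP : ∀ v, P v * P v = P v)
    (hsum : ∑ v, P v = (x : ℂ) • 1)
    (p : Fin n → S) (hps : ∀ v, star (p v) = p v) (hpp : ∀ v, p v * p v - p v ∈ I)
    (hsp : (x : ℂ) • 1 - ∑ v, p v ∈ I)
    (hgen : ∀ U : Submodule ℂ S, 1 ∈ U → (∀ v, ∀ a ∈ U, p v * a ∈ U) → U = ⊤)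
    (hFD : FD n x) :
    ∃ f : Fin d → S, 1 - ∑ j, star (f j) * f j ∈ I ∧
      ∀ v, p v - ∑ j, ∑ k, P v j k • (star (f j) * f k) ∈ I := by
  let π : S →+* S ⧸ I := Ideal.Quotient.mk I
  have hπ : Function.Surjective π := Ideal.Quotient.mk_surjective
  have hπI : ∀ a b, π a = π b ↔ a - b ∈ I := fun a b => Ideal.Quotient.eq
  have hπs : ∀ (c : ℂ) a, π (c • a) = c • π a := fun c a => rfl
  let st : S ⧸ I → S ⧸ I := Quotient.map' star (by
    intro a b h
    rw [Submodule.quotientRel_def] at h ⊢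
    rw [← star_sub]
    exact hIs _ h)
  have hst : ∀ a, st (π a) = π (star a) := fun a => rfl
  letI iS : StarRing (S ⧸ I) :=
    { star := st
      star_involutive := by
        intro a
        obtain ⟨a, rfl⟩ := hπ a
        change st (st (π a)) = π a
        rw [hst, hst, star_star]
      star_mul := by
        intro a b
        obtain ⟨a, rfl⟩ := hπ a
        obtain ⟨b, rfl⟩ := hπ b
        change st (π a * π b) = st (π b) * st (π a)
        rw [← map_mul, hst, hst, hst, star_mul, map_mul]
      star_add := by
        intro a b
        obtain ⟨a, rfl⟩ := hπ a
        obtain ⟨b, rfl⟩ := hπ b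
        change st (π a + π b) = st (π a) + st (π b)
        rw [← map_add, hst, hst, hst, star_add, map_add] }
  have hst' : ∀ a, star (π a) = π (star a) := fun a => rfl
  haveI iM : StarModule ℂ (S ⧸ I) := ⟨by
    intro c a
    obtain ⟨a, rfl⟩ := hπ a
    rw [← hπs, hst', hst', star_smul, hπs]⟩
  have hR : Rl (S ⧸ I) := by
    intro ι _ a ha i
    choose a' ha' using fun i => hπ (a i)
    have h1 : ∑ i, star (a' i) * a' i ∈ I := by
      have := (hπI (∑ i, star (a' i) * a' i) 0).1 (by
        rw [map_zero, ← ha, map_sum]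
        exact Finset.sum_congr rfl fun i _ => by rw [map_mul, ← hst', ha'])
      simpa using this
    have h2 := hIr ι a' h1 i
    rw [← ha', ← map_zero π, hπI, sub_zero]
    exact h2
  obtain ⟨f, hf1, hf2⟩ := main_abs hR hd hcop x hbd hq hn P hPs hP hsum (fun v => π (p v))
    (fun v => by rw [hst', hps]) (fun v => by rw [← map_mul, hπI]; exact hpp v)
    (by rw [← map_sum, ← map_one π, ← hπs]; exact ((hπI _ _).2 hsp).symm)
    (by
      intro U h1 h2
      have := hgen (U.comap (I.mkQ.restrictScalars ℂ)) h1 (fun v a ha => h2 v _ ha)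
      rw [eq_top_iff]
      intro a _
      obtain ⟨a, rfl⟩ := hπ a
      have h3 : a ∈ U.comap (I.mkQ.restrictScalars ℂ) := by rw [this]; trivial
      exact h3) hFD
  choose f' hf' using fun i => hπ (f i)
  refine ⟨f', ?_, fun v => ?_⟩
  · rw [← hπI, map_one, ← hf1, map_sum]
    exact Finset.sum_congr rfl fun i _ => by rw [map_mul, ← hst', hf']
  · rw [← hπI, ← hf2, map_sum]
    refine Finset.sum_congr rfl fun i _ => ?_
    rw [map_sum]
    exact Finset.sum_congr rfl fun j _ => by rw [hπs, map_mul, ← hst', hf', hf']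
end quot

/-- index type of all instances -/
structure Om (n : ℕ) : Type where
  r : ℕ
  ρ : Matrix (Fin r) (Fin r) ℂ
  E : Fin n → Matrix (Fin r) (Fin r) ℂ
  hρ : ρ.PosSemidef
  htr : ρ.trace = 1
  hE : ∀ v, (E v).PosSemidef ∧ (1 - E v).PosSemidef

/-- the approximate relations -/
def Good {n : ℕ} (x δ : ℝ) (m : ℕ) (ω : Om n) : Prop :=
  (∀ v, rnorm ω.ρ (ω.E v * ω.E v - ω.E v) ≤ δ) ∧
  rnorm ω.ρ ((x : ℂ) • 1 - ∑ v, ω.E v) ≤ δ ∧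
  (∀ L1 L2 : List (Fin n), L1.length ≤ m → L2.length ≤ m →
    ‖((((L1.map ω.E).prod * (L2.map ω.E).prod
      - (L2.map ω.E).prod * (L1.map ω.E).prod) * ω.ρ).trace)‖ ≤ δ)

lemma Good.mono {n : ℕ} {x δ δ' : ℝ} {m m' : ℕ} {ω : Om n} (h : Good x δ m ω) (hδ : δ ≤ δ')
    (hm : m' ≤ m) : Good x δ' m' ω :=
  ⟨fun v => (h.1 v).trans hδ, h.2.1.trans hδ,
    fun L1 L2 h1 h2 => (h.2.2 L1 L2 (h1.trans hm) (h2.trans hm)).trans hδ⟩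

/-- the filter of good instances -/
def FF (n : ℕ) (x : ℝ) : Filter (Om n) where
  sets := {T | ∃ (δ : ℝ) (m : ℕ), 0 < δ ∧ ∀ ω, Good x δ m ω → ω ∈ T}
  univ_sets := ⟨1, 0, one_pos, fun _ _ => trivial⟩
  sets_of_superset := by
    rintro T T' ⟨δ, m, hδ, h⟩ hT
    exact ⟨δ, m, hδ, fun ω hω => hT (h ω hω)⟩
  inter_sets := by
    rintro T T' ⟨δ, m, hδ, h⟩ ⟨δ', m', hδ', h'⟩
    exact ⟨min δ δ', max m m', lt_min hδ hδ', fun ω hω =>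
      ⟨h ω (hω.mono (min_le_left _ _) (le_max_left _ _)),
        h' ω (hω.mono (min_le_right _ _) (le_max_right _ _))⟩⟩

lemma ev_good {n : ℕ} (x : ℝ) {δ : ℝ} (m : ℕ) (hδ : 0 < δ) : ∀ᶠ ω in FF n x, Good x δ m ω :=
  ⟨δ, m, hδ, fun _ h => h⟩

abbrev MM (n : ℕ) : Type := ∀ ω : Om n, Matrix (Fin ω.r) (Fin ω.r) ℂ

def gE {n : ℕ} (v : Fin n) : MM n := fun ω => ω.E v

def wd {n : ℕ} (L : List (Fin n)) : MM n := (L.map gE).prod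

lemma wd_apply {n : ℕ} (L : List (Fin n)) (ω : Om n) : wd L ω = (L.map ω.E).prod := by
  induction L with
  | nil => rfl
  | cons v L ih =>
    have : wd (v :: L) = gE v * wd L := by simp [wd]
    rw [this, Pi.mul_apply, ih]
    simp [gE]

def SS (n : ℕ) : StarSubalgebra ℂ (MM n) := StarAlgebra.adjoin ℂ (Set.range (gE (n := n)))

lemma star_gE {n : ℕ} (v : Fin n) : star (gE v) = gE v := by
  ext1 ω
  exact (ω.hE v).1.isHermitian.eq

lemma gE_mem {n : ℕ} (v : Fin n) : gE v ∈ SS n := StarAlgebra.subset_adjoin _ _ ⟨v, rfl⟩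

lemma wd_mem {n : ℕ} (L : List (Fin n)) : wd L ∈ SS n := by
  apply list_prod_mem
  intro a ha
  obtain ⟨v, -, rfl⟩ := List.mem_map.1 ha
  exact gE_mem v

lemma SS_span {n : ℕ} {a : MM n} (ha : a ∈ SS n) : a ∈ Submodule.span ℂ (Set.range (wd (n := n))) := by
  have h1 : a ∈ Subalgebra.toSubmodule (StarAlgebra.adjoin ℂ (Set.range (gE (n := n)))).toSubalgebra := ha
  rw [StarAlgebra.adjoin_eq_span] at h1
  refine Submodule.span_mono ?_ h1
  intro b hb
  obtain ⟨l, hl, rfl⟩ := Submonoid.exists_list_of_mem_closure hb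
  have h2 : ∀ y ∈ l, ∃ v, gE v = y := by
    intro y hy
    rcases hl y hy with h | ⟨v, hv⟩
    · exact h
    · exact ⟨v, by rw [← star_star y, ← hv, star_gE]⟩
  clear hl hb h1
  induction l with
  | nil => exact ⟨[], rfl⟩
  | cons y l ih =>
    obtain ⟨v, rfl⟩ := h2 y (by simp)
    obtain ⟨L, hL⟩ := ih (fun y hy => h2 y (by simp [hy]))
    exact ⟨v :: L, by simp [wd, ← hL]⟩

lemma SS_bdd0 {n : ℕ} {a : MM n} (ha : a ∈ Submodule.span ℂ (Set.range (wd (n := n)))) : ∃ c : ℝ, 0 ≤ c ∧ ∀ ω, Bd c (a ω) := by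
  induction ha using Submodule.span_induction with
  | mem a h =>
    obtain ⟨L, rfl⟩ := h
    refine ⟨1, zero_le_one, fun ω => ?_⟩
    rw [wd_apply]
    induction L with
    | nil => simpa using Bd_one
    | cons v L ih =>
      rw [List.map_cons, List.prod_cons]
      have := (Bd_contr (ω.hE v).1 (ω.hE v).2).mul zero_le_one ih
      rwa [one_mul] at this
  | zero => exact ⟨0, le_rfl, fun ω => by simpa [Bd] using Matrix.PosSemidef.zero⟩
  | add a b _ _ h1 h2 =>
    obtain ⟨c, hc, h1⟩ := h1
    obtain ⟨c', hc', h2⟩ := h2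
    exact ⟨2 * c + 2 * c', by positivity, fun ω => (h1 ω).add (h2 ω)⟩
  | smul k a _ h =>
    obtain ⟨c, hc, h⟩ := h
    exact ⟨‖k‖ ^ 2 * c, by positivity, fun ω => (h ω).smul k⟩

lemma SS_bdd {n : ℕ} {a : MM n} (ha : a ∈ SS n) : ∃ c : ℝ, 0 ≤ c ∧ ∀ ω, Bd c (a ω) :=
  SS_bdd0 (SS_span ha)

lemma comm_tend {n : ℕ} (x : ℝ) {a b : MM n} (ha : a ∈ SS n) (hb : b ∈ SS n) :
    Filter.Tendsto (fun ω : Om n => ((a ω * b ω - b ω * a ω) * ω.ρ).trace) (FF n x) (nhds 0) := by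
  have ha' := SS_span ha
  have hb' := SS_span hb
  clear ha hb
  induction ha' using Submodule.span_induction with
  | zero => simpa using tendsto_const_nhds
  | add a a' _ _ h1 h2 =>
    convert h1.add h2 using 1
    · ext ω
      rw [← Matrix.trace_add, ← add_mul]
      congr 2
      simp only [Pi.add_apply]
      noncomm_ring
    · simp
  | smul k a _ h =>
    convert h.const_mul k using 1
    · ext ω
      rw [← smul_eq_mul k, ← Matrix.trace_smul, ← Matrix.smul_mul]
      congr 2
      simp [smul_sub]
    · simp
  | mem a h =>
    obtain ⟨L, rfl⟩ := h
    induction hb' using Submodule.span_induction with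
    | zero => simpa using tendsto_const_nhds
    | add a a' _ _ h1 h2 =>
      convert h1.add h2 using 1
      · ext ω
        rw [← Matrix.trace_add, ← add_mul]
        congr 2
        simp only [Pi.add_apply]
        noncomm_ring
      · simp
    | smul k a _ h =>
      convert h.const_mul k using 1
      · ext ω
        rw [← smul_eq_mul k, ← Matrix.trace_smul, ← Matrix.smul_mul]
        congr 2
        simp [smul_sub]
      · simp
    | mem b h =>
      obtain ⟨L', rfl⟩ := h
      rw [Metric.tendsto_nhds]
      intro e he
      filter_upwards [ev_good x (max L.length L'.length) (half_pos he)] with ω hω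
      rw [dist_zero_right, wd_apply, wd_apply]
      exact (hω.2.2 L L' (le_max_left _ _) (le_max_right _ _)).trans_lt (half_lt_self he)

/-- asymptotically null elements -/
def Null {n : ℕ} (x : ℝ) (a : MM n) : Prop :=
  Filter.Tendsto (fun ω : Om n => nsq ω.ρ (a ω)) (FF n x) (nhds 0)

lemma Null.of_le {n : ℕ} {x : ℝ} {a : MM n} {g : Om n → ℝ} (hg : Filter.Tendsto g (FF n x) (nhds 0))
    (h : ∀ ω, nsq ω.ρ (a ω) ≤ g ω) : Null x a :=
  squeeze_zero (fun ω => nsq_nonneg ω.hρ _) h hg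

lemma Null.add {n : ℕ} {x : ℝ} {a b : MM n} (ha : Null x a) (hb : Null x b) : Null x (a + b) :=
  Null.of_le (by simpa using (ha.const_mul 2).add (hb.const_mul 2)) fun ω => nsq_add_le ω.hρ _ _

lemma Null.mul_bdd {n : ℕ} {x : ℝ} {a b : MM n} {c : ℝ} (hb : ∀ ω, Bd c (b ω)) (ha : Null x a) :
    Null x (b * a) :=
  Null.of_le (by simpa using ha.const_mul c) fun ω => nsq_mul_le ω.hρ (hb ω) _

lemma Null.mul_left {n : ℕ} {x : ℝ} {a b : MM n} (hb : b ∈ SS n) (ha : Null x a) :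
    Null x (b * a) := by
  obtain ⟨c, -, hc⟩ := SS_bdd hb
  exact ha.mul_bdd hc

lemma Null.star {n : ℕ} {x : ℝ} {a : MM n} (hs : a ∈ SS n) (ha : Null x a) :
    Null x (star a) := by
  have h1 := Filter.Tendsto.add ha
    ((Complex.continuous_re.tendsto 0).comp (comm_tend x hs (star_mem hs)))
  simp only [Complex.zero_re, add_zero] at h1
  refine Null.of_le h1 fun ω => le_of_eq ?_
  simp only [nsq, Function.comp, ← Complex.add_re, ← Matrix.trace_add, ← add_mul]
  congr 3
  simp only [Pi.star_apply, Matrix.star_eq_conjTranspose, Matrix.conjTranspose_conjTranspose]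
  abel

lemma null_of_sum {n : ℕ} {x : ℝ} {ι : Type} [Fintype ι] {a : ι → MM n}
    (h : Null x (∑ i, star (a i) * a i)) (i : ι) : Null x (a i) := by
  have h1 : Filter.Tendsto (fun ω : Om n => Real.sqrt (nsq ω.ρ ((∑ i, star (a i) * a i) ω)))
      (FF n x) (nhds 0) := by
    have := (Real.continuous_sqrt.tendsto 0).comp h
    rw [Real.sqrt_zero] at this
    exact this
  refine Null.of_le h1 fun ω => ?_
  have h2 : nsq ω.ρ (a i ω) ≤ ∑ j, nsq ω.ρ (a j ω) :=
    Finset.single_le_sum (f := fun j => nsq ω.ρ (a j ω)) (fun j _ => nsq_nonneg ω.hρ _) (Finset.mem_univ i)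
  have h3 : ∑ j, nsq ω.ρ (a j ω) = (((∑ i, star (a i) * a i) ω * ω.ρ).trace).re := by
    simp only [nsq, Finset.sum_apply, Finset.sum_mul, Matrix.trace_sum, Complex.re_sum]
    rfl
  rw [h3] at h2
  refine h2.trans ((Complex.re_le_norm _).trans ?_)
  exact Real.le_sqrt_of_sq_le (tr_sq_le ω.hρ ω.htr _)

lemma nsq_le_sq {r : ℕ} {ρ X : Matrix (Fin r) (Fin r) ℂ} {δ : ℝ} (hδ : 0 ≤ δ) (h : rnorm ρ X ≤ δ) :
    nsq ρ X ≤ δ ^ 2 := (Real.sqrt_le_left hδ).1 h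

lemma null_of_ev {n : ℕ} {x : ℝ} {a : MM n}
    (h : ∀ (δ : ℝ) (m : ℕ) (ω : Om n), Good x δ m ω → rnorm ω.ρ (a ω) ≤ δ) : Null x a := by
  unfold Null
  rw [Metric.tendsto_nhds]
  intro e he
  filter_upwards [ev_good x 0 (Real.sqrt_pos.2 (half_pos he))] with ω hω
  have := nsq_le_sq (Real.sqrt_nonneg _) (h _ _ ω hω)
  rw [Real.sq_sqrt (half_pos he).le] at this
  rw [Real.dist_eq, sub_zero, abs_of_nonneg (nsq_nonneg ω.hρ _)]
  linarith

lemma null_zero {n : ℕ} {x : ℝ} : Null x (0 : MM n) :=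
  Null.of_le tendsto_const_nhds fun ω => le_of_eq (by simp [nsq])

def II (n : ℕ) (x : ℝ) : Ideal (SS n) where
  carrier := {a | Null x (a : MM n)}
  zero_mem' := null_zero
  add_mem' := fun ha hb => Null.add ha hb
  smul_mem' := fun b _ ha => Null.mul_left b.2 ha

lemma exists_f {n b d : ℕ} (hn : 3 ≤ n) (x : ℝ) (hx : x ∈ Lambda n)
    (hd : 0 < d) (hcop : Nat.Coprime b d) (hbd : x = (b : ℝ) / d)
    (P : Fin n → Matrix (Fin d) (Fin d) ℂ)
    (hP : ∀ v, IsProjection (P v)) (hsum : ∑ v, P v = (x : ℂ) • 1) :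
    ∃ f : Fin d → MM n, (∀ j, f j ∈ SS n) ∧ Null x (1 - ∑ j, star (f j) * f j) ∧
      ∀ v, Null x (gE v - ∑ j, ∑ k, P v j k • (star (f j) * f k)) := by
  obtain ⟨hF, hq⟩ := num_main hn x hx hd hcop hbd
  have hIs : ∀ a ∈ II n x, star a ∈ II n x := fun a ha => Null.star a.2 ha
  obtain ⟨f, hf1, hf2⟩ := abs_quot (II n x)
    ⟨fun {a} c ha => by
      have : star (star c * star a) ∈ II n x := hIs _ ((II n x).mul_mem_left _ (hIs _ ha))
      simpa using this⟩
    hIs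
    (fun ι _ a ha i => null_of_sum (a := fun i => (a i : MM n)) (by
      have : Null x ((∑ i, star (a i) * a i : SS n) : MM n) := ha
      simpa using this) i)
    hd hcop x hbd hq (by omega) P (fun v => (hP v).1) (fun v => (hP v).2) hsum
    (fun v => ⟨gE v, gE_mem v⟩) (fun v => Subtype.ext (star_gE v))
    (fun v => null_of_ev fun δ m ω h => h.1 v)
    (null_of_ev fun δ m ω h => by
      have := h.2.1
      convert this using 2
      simp [gE, Finset.sum_apply])
    (by
      intro U h1 h2
      have hw : ∀ L : List (Fin n), (⟨wd L, wd_mem L⟩ : SS n) ∈ U := by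
        intro L
        induction L with
        | nil => exact h1
        | cons v L ih =>
          convert h2 v _ ih using 1
          exact Subtype.ext (by simp [wd])
      rw [eq_top_iff]
      rintro ⟨a, ha⟩ -
      have h3 : Submodule.span ℂ (Set.range (wd (n := n))) ≤ U.map (SS n).subtype.toLinearMap := by
        rw [Submodule.span_le]
        rintro _ ⟨L, rfl⟩
        exact ⟨_, hw L, rfl⟩
      obtain ⟨a', ha', h4⟩ := h3 (SS_span ha)
      have h5 : (⟨a, ha⟩ : SS n) = a' := Subtype.ext h4.symm
      rw [h5]
      exact ha')
    hF
  refine ⟨fun j => f j, fun j => (f j).2, ?_, fun v => ?_⟩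
  · have : Null x ((1 - ∑ j, star (f j) * f j : SS n) : MM n) := hf1
    simpa using this
  · have : Null x ((⟨gE v, gE_mem v⟩ - ∑ j, ∑ k, P v j k • (star (f j) * f k) : SS n) : MM n) := hf2 v
    simpa using this

section build
variable {r d : ℕ}

/-- block isometry -/
def VV (G : Fin d → Fin 2 → Matrix (Fin r) (Fin r) ℂ) : Matrix (Fin d × Fin (2 * r)) (Fin r) ℂ :=
  Matrix.of fun y c => G y.1 (finProdFinEquiv.symm y.2).1 (finProdFinEquiv.symm y.2).2 c

lemma VV_conj (G : Fin d → Fin 2 → Matrix (Fin r) (Fin r) ℂ) (P : Matrix (Fin d) (Fin d) ℂ) :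
    (VV G)ᴴ * (P ⊗ₖ (1 : Matrix (Fin (2 * r)) (Fin (2 * r)) ℂ)) * VV G
      = ∑ j, ∑ k, P j k • ((G j 0)ᴴ * G k 0 + (G j 1)ᴴ * G k 1) := by
  ext a c
  have h1 : ∀ k (y : Fin (2 * r)),
      ((VV G)ᴴ * (P ⊗ₖ (1 : Matrix (Fin (2 * r)) (Fin (2 * r)) ℂ))) a (k, y)
        = ∑ j, star (VV G (j, y) a) * P j k := by
    intro k y
    simp only [Matrix.mul_apply, Fintype.sum_prod_type, Matrix.kroneckerMap_apply,
      Matrix.conjTranspose_apply, Matrix.one_apply]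
    refine Finset.sum_congr rfl fun j _ => ?_
    simp
  rw [Matrix.mul_apply, Fintype.sum_prod_type]
  simp only [h1]
  have h2 : ∀ F : Fin (2 * r) → ℂ, ∑ y, F y = ∑ t : Fin 2, ∑ i : Fin r, F (finProdFinEquiv (t, i)) := by
    intro F
    rw [← Fintype.sum_prod_type', ← finProdFinEquiv.sum_comp]
  simp only [h2, VV, Matrix.of_apply, Equiv.symm_apply_apply, Fin.sum_univ_two, Matrix.sum_apply,
    Matrix.smul_apply, Matrix.add_apply, Matrix.mul_apply, Matrix.conjTranspose_apply, smul_eq_mul]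
  rw [Finset.sum_comm]
  simp only [← Finset.sum_add_distrib, Finset.sum_mul, Finset.mul_sum, mul_add]
  refine Finset.sum_congr rfl fun k _ => ?_
  rw [Finset.sum_comm]
  exact Finset.sum_congr rfl fun j _ => Finset.sum_congr rfl fun i _ => by ring

lemma build (j0 : Fin d) (f : Fin d → Matrix (Fin r) (Fin r) ℂ) :
    ∃ (Sg : Matrix (Fin r) (Fin r) ℂ) (V : Matrix (Fin d × Fin (2 * r)) (Fin r) ℂ),
      Bd 1 Sg ∧ (∃ R, Bd 1 R ∧ Sg = R * (1 - ∑ j, (f j)ᴴ * f j)) ∧ Vᴴ * V = 1 ∧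
      ∀ P : Matrix (Fin d) (Fin d) ℂ, ∀ Q, Q = ∑ j, ∑ k, P j k • ((f j)ᴴ * f k) →
        Vᴴ * (P ⊗ₖ (1 : Matrix (Fin (2 * r)) (Fin (2 * r)) ℂ)) * V
          = Q + Sg * Q + Q * Sg + Sg * (Q * Sg) + P j0 j0 • (Sg * Sg) := by
  set T := ∑ j, (f j)ᴴ * f j with hT
  have hTp : T.PosSemidef := Matrix.posSemidef_sum _ fun j _ => Matrix.posSemidef_conjTranspose_mul_self _
  have hD : (1 + T).PosDef := Matrix.PosDef.one.add_posSemidef hTp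
  have hU : IsUnit (1 + T).det := (Matrix.isUnit_iff_isUnit_det _).1 hD.isUnit
  set R := (1 + T)⁻¹ with hR
  have hRl : R * (1 + T) = 1 := Matrix.nonsing_inv_mul _ hU
  have hRr : (1 + T) * R = 1 := Matrix.mul_nonsing_inv _ hU
  have hRs : Rᴴ = R := hD.inv.isHermitian.eq
  have hTs : Tᴴ = T := hTp.isHermitian.eq
  have hRT : R * T = 1 - R := by rw [← hRl]; noncomm_ring
  have hTR : T * R = 1 - R := by rw [← hRr]; noncomm_ring
  set Sg := R * (1 - T) with hSg
  have hS2 : Sg = R + R - 1 := by rw [hSg, mul_sub, hRT]; noncomm_ring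
  have hSs : Sgᴴ = Sg := by
    rw [hS2, Matrix.conjTranspose_sub, Matrix.conjTranspose_add, hRs, Matrix.conjTranspose_one]
  have hR2 : R + R = 1 + Sg := by rw [hS2]; abel
  have hRTR : R * T * R = R - R * R := by rw [hRT]; noncomm_ring
  -- bounds
  have hBS : Bd 1 Sg := by
    unfold Bd
    have h1 := psd_smul (c := 4) (by norm_num) (hTp.conjTranspose_mul_mul_same R)
    convert h1 using 1
    rw [hRs, hRTR, hSs, hS2]
    have : ((4 : ℝ) : ℂ) • (R - R * R) = (R - R * R) + (R - R * R) + (R - R * R) + (R - R * R) := by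
      module
    rw [this, Complex.ofReal_one, one_smul]
    noncomm_ring
  have hBR : Bd 1 R := by
    unfold Bd
    have h1 := (hTp.add hTp).conjTranspose_mul_mul_same R
    have h2 := Matrix.posSemidef_conjTranspose_mul_self (T * R)
    convert h1.add h2 using 1
    rw [Matrix.conjTranspose_mul, hRs, hTs]
    have e1 : R * (T + T) * R = R * T * R + R * T * R := by noncomm_ring
    rw [e1, hRTR, hRT, hTR, Complex.ofReal_one, one_smul]
    noncomm_ring
  let G : Fin d → Fin 2 → Matrix (Fin r) (Fin r) ℂ := fun j t =>
    if t = 0 then f j * (R + R) else if j = j0 then Sg else 0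
  have hG0 : ∀ j, G j 0 = f j * (R + R) := fun j => rfl
  have hG1 : ∀ j, G j 1 = if j = j0 then Sg else 0 := fun j => rfl
  have hG1s : ∀ j, (G j 1)ᴴ = if j = j0 then Sg else 0 := fun j => by
    rw [hG1]; split_ifs <;> simp [hSs]
  have hRRs : (R + R)ᴴ = R + R := by rw [Matrix.conjTranspose_add, hRs]
  have key : ∀ P : Matrix (Fin d) (Fin d) ℂ,
      ∑ j, ∑ k, P j k • ((G j 0)ᴴ * G k 0 + (G j 1)ᴴ * G k 1)
      = (R + R) * (∑ j, ∑ k, P j k • ((f j)ᴴ * f k)) * (R + R) + P j0 j0 • (Sg * Sg) := by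
    intro P
    simp only [smul_add, Finset.sum_add_distrib]
    congr 1
    · simp only [hG0, Matrix.conjTranspose_mul, hRRs, Finset.mul_sum, Finset.sum_mul, Matrix.smul_mul,
        Matrix.mul_smul, mul_assoc]
    · simp only [hG1s]
      simp [hG1]
  refine ⟨Sg, VV G, hBS, ⟨R, hBR, rfl⟩, ?_, ?_⟩
  · have h1 := key 1
    have h2 := VV_conj G 1
    rw [Matrix.one_kronecker_one, Matrix.mul_one] at h2
    have h3 : ∑ j, ∑ k, (1 : Matrix (Fin d) (Fin d) ℂ) j k • ((f j)ᴴ * f k) = T := by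
      rw [hT]
      refine Finset.sum_congr rfl fun j _ => ?_
      simp [Matrix.one_apply]
    rw [h2, h1, h3, Matrix.one_apply_eq, one_smul]
    have e1 : (R + R) * T * (R + R) = R * T * R + R * T * R + R * T * R + R * T * R := by noncomm_ring
    rw [e1, hRTR, hS2]
    noncomm_ring
  · intro P Q hQ
    rw [VV_conj, key, ← hQ, hR2]
    noncomm_ring

end build

lemma Null.mul_right {n : ℕ} {x : ℝ} {a b : MM n} (hs : a ∈ SS n) (hb : b ∈ SS n) (ha : Null x a) :
    Null x (a * b) := by
  have := Null.star (mul_mem (star_mem hb) (star_mem hs)) ((Null.star hs ha).mul_left (star_mem hb))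
  simpa using this

lemma Null.smul {n : ℕ} {x : ℝ} {a : MM n} (ha : Null x a) (c : ℂ) : Null x (c • a) :=
  Null.of_le (by simpa using ha.const_mul (‖c‖ ^ 2)) fun ω => (nsq_smul c (a ω)).le

lemma Null.neg {n : ℕ} {x : ℝ} {a : MM n} (ha : Null x a) : Null x (-a) :=
  Null.of_le ha fun ω => (nsq_neg (a ω)).le

theorem statement13 {n b d : ℕ} (hn : 3 ≤ n) (x : ℝ) (hx : x ∈ Lambda n)
    (hd : 0 < d) (hcop : Nat.Coprime b d) (hbd : x = (b : ℝ) / d)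
    (Pt : Fin n → Matrix (Fin d) (Fin d) ℂ)
    (hPt : ∀ v, IsProjection (Pt v)) (hPtsum : ∑ v, Pt v = (x : ℂ) • 1)
    (ε : ℝ) (hε : 0 < ε) :
    ∃ (δ : ℝ) (m : ℕ), 0 < δ ∧
      ∀ (r : ℕ) (ρ : Matrix (Fin r) (Fin r) ℂ), ρ.PosSemidef → ρ.trace = 1 →
        ∀ E : Fin n → Matrix (Fin r) (Fin r) ℂ,
          (∀ v, (E v).PosSemidef ∧ (1 - E v).PosSemidef) →
          (∀ v, rnorm ρ (E v * E v - E v) ≤ δ) →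
          rnorm ρ ((x : ℂ) • 1 - ∑ v, E v) ≤ δ →
          (∀ L1 L2 : List (Fin n), L1.length ≤ m → L2.length ≤ m →
            ‖((((L1.map E).prod * (L2.map E).prod
              - (L2.map E).prod * (L1.map E).prod) * ρ).trace)‖ ≤ δ) →
          ∃ (s : ℕ) (V : Matrix (Fin d × Fin s) (Fin r) ℂ), Vᴴ * V = 1 ∧
            ∀ v, rnorm ρ
              (E v - Vᴴ * (Pt v ⊗ₖ (1 : Matrix (Fin s) (Fin s) ℂ)) * V) ≤ ε := by
  obtain ⟨f, hfS, hf1, hf2⟩ := exists_f hn x hx hd hcop hbd Pt hPt hPtsum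
  choose Sg V hS hR hV hVP using fun ω : Om n => build (⟨0, hd⟩ : Fin d) (fun j => f j ω)
  choose R hRb hRe using hR
  have hTS : (1 - ∑ j, star (f j) * f j : MM n) ∈ SS n :=
    sub_mem (one_mem _) (sum_mem fun j _ => mul_mem (star_mem (hfS j)) (hfS j))
  have hSe : (Sg : MM n) = R * (1 - ∑ j, star (f j) * f j) := by
    ext1 ω
    rw [hRe]
    simp [Matrix.star_eq_conjTranspose]
  have hSN : Null x (Sg : MM n) := by
    rw [hSe]
    exact hf1.mul_bdd hRb
  let Q : Fin n → MM n := fun v => ∑ j, ∑ k, Pt v j k • (star (f j) * f k)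
  have hQS : ∀ v, Q v ∈ SS n := fun v => sum_mem fun j _ => sum_mem fun k _ =>
    SMulMemClass.smul_mem _ (mul_mem (star_mem (hfS j)) (hfS k))
  have hQe : ∀ v ω, Q v ω = ∑ j, ∑ k, Pt v j k • ((f j ω)ᴴ * f k ω) := by
    intro v ω
    simp [Q, Matrix.star_eq_conjTranspose]
  have hN : ∀ v, Null x (fun ω => ω.E v -
      (V ω)ᴴ * (Pt v ⊗ₖ (1 : Matrix (Fin (2 * ω.r)) (Fin (2 * ω.r)) ℂ)) * V ω) := by
    intro v
    have h1 : Null x (Sg * Q v) := by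
      rw [hSe, mul_assoc]
      exact (hf1.mul_right hTS (hQS v)).mul_bdd hRb
    have h2 : Null x (Q v * Sg) := hSN.mul_left (hQS v)
    have h3 : Null x (Sg * (Q v * Sg)) := h2.mul_bdd hS
    have h4 : Null x (Pt v ⟨0, hd⟩ ⟨0, hd⟩ • (Sg * Sg)) := (hSN.mul_bdd hS).smul _
    have h5 := ((((hf2 v).add h1.neg).add h2.neg).add h3.neg).add h4.neg
    convert h5 using 1
    ext1 ω
    rw [hVP ω (Pt v) (Q v ω) (hQe v ω)]
    change _ = gE v ω - Q v ω + -(Sg ω * Q v ω) + -(Q v ω * Sg ω) + -(Sg ω * (Q v ω * Sg ω))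
      + -(Pt v ⟨0, hd⟩ ⟨0, hd⟩ • (Sg ω * Sg ω))
    simp only [gE]
    abel
  have hev : ∀ᶠ ω in FF n x, ∀ v, nsq ω.ρ (ω.E v -
      (V ω)ᴴ * (Pt v ⊗ₖ (1 : Matrix (Fin (2 * ω.r)) (Fin (2 * ω.r)) ℂ)) * V ω) < ε ^ 2 :=
    Filter.eventually_all.2 fun v => (hN v).eventually (gt_mem_nhds (by positivity))
  obtain ⟨δ, m, hδ, h⟩ := hev
  refine ⟨δ, m, hδ, fun r ρ hρ htr E hE ha hb hc => ?_⟩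
  let ω : Om n := ⟨r, ρ, E, hρ, htr, hE⟩
  have hω := h ω ⟨ha, hb, hc⟩
  exact ⟨2 * r, V ω, hV ω, fun v => Real.sqrt_le_iff.2 ⟨hε.le, (hω v).le⟩⟩

end QST
end
end

section
/- Let ξ, η ∈ ℂ^d and let P ∈ M_d(ℂ) be an orthogonal projection. Suppose |‖ξ‖² − ‖η‖²| ≤ ε_1 and ‖ξ − Pη‖ ≤ ε_2 for some ε_1, ε_2 ≥ 0. Then ‖ξ − η‖ ≤ ε_2 + √(ε_1 + (‖ξ‖ + ‖η‖)·ε_2). -/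
open scoped Matrix Kronecker ComplexOrder

noncomputable section
namespace QST

lemma evnorm_eq {ι : Type} [Fintype ι] (v : ι → ℂ) : evnorm v = ‖WithLp.toLp 2 v‖ := by
  rw [EuclideanSpace.norm_eq]; rfl

lemma proj_pyth {d : ℕ} (η : Fin d → ℂ) (P : Matrix (Fin d) (Fin d) ℂ) (hP : IsProjection P) :
    ‖WithLp.toLp 2 η‖ ^ 2 =
      ‖WithLp.toLp 2 (P.mulVec η)‖ ^ 2 + ‖WithLp.toLp 2 (η - P.mulVec η)‖ ^ 2 := by
  have h0 : inner ℂ (WithLp.toLp 2 (P.mulVec η)) (WithLp.toLp 2 (η - P.mulVec η)) = (0 : ℂ) := by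
    rw [EuclideanSpace.inner_toLp_toLp, dotProduct_comm, Matrix.star_mulVec, hP.1,
      ← Matrix.dotProduct_mulVec, Matrix.mulVec_sub, Matrix.mulVec_mulVec, hP.2, sub_self,
      dotProduct_zero]
  have h := norm_add_sq_eq_norm_sq_add_norm_sq_of_inner_eq_zero _ _ h0
  rw [← WithLp.toLp_add, add_sub_cancel] at h
  nlinarith [h]

theorem statement16 {d : ℕ} (ξ η : Fin d → ℂ) (P : Matrix (Fin d) (Fin d) ℂ)
    (hP : IsProjection P) (ε1 ε2 : ℝ) (hε1 : 0 ≤ ε1) (hε2 : 0 ≤ ε2)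
    (h1 : |evnorm ξ ^ 2 - evnorm η ^ 2| ≤ ε1)
    (h2 : evnorm (ξ - P.mulVec η) ≤ ε2) :
    evnorm (ξ - η) ≤ ε2 + Real.sqrt (ε1 + (evnorm ξ + evnorm η) * ε2) := by
  have hp := proj_pyth η P hP
  simp only [evnorm_eq] at *
  have hab : WithLp.toLp 2 (ξ - η) =
      WithLp.toLp 2 (ξ - P.mulVec η) - WithLp.toLp 2 (η - P.mulVec η) := by
    rw [← WithLp.toLp_sub]; congr 1; abel
  have ht := norm_sub_le (WithLp.toLp 2 (ξ - P.mulVec η)) (WithLp.toLp 2 (η - P.mulVec η))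
  rw [← hab] at ht
  have hr := norm_sub_norm_le (WithLp.toLp 2 ξ) (WithLp.toLp 2 (P.mulVec η))
  rw [← WithLp.toLp_sub] at hr
  have hle : ‖WithLp.toLp 2 (P.mulVec η)‖ ≤ ‖WithLp.toLp 2 η‖ := by
    exact (sq_le_sq₀ (norm_nonneg _) (norm_nonneg _)).1 (by nlinarith [sq_nonneg ‖WithLp.toLp 2 (η - P.mulVec η)‖])
  have hs : ‖WithLp.toLp 2 (η - P.mulVec η)‖ ≤
      Real.sqrt (ε1 + (‖WithLp.toLp 2 ξ‖ + ‖WithLp.toLp 2 η‖) * ε2) := by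
    apply Real.le_sqrt_of_sq_le
    have h3 := (abs_le.1 h1).1
    have h4 : (‖WithLp.toLp 2 ξ‖ + ‖WithLp.toLp 2 (P.mulVec η)‖) *
        (‖WithLp.toLp 2 ξ‖ - ‖WithLp.toLp 2 (P.mulVec η)‖) ≤
        (‖WithLp.toLp 2 ξ‖ + ‖WithLp.toLp 2 (P.mulVec η)‖) * ε2 :=
      mul_le_mul_of_nonneg_left (hr.trans h2) (by positivity)
    have h5 := mul_le_mul_of_nonneg_right hle hε2
    nlinarith
  linarith

end QST
end
end
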